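/- arXiv:1407.2380 — 2 statements merged into one kernel-verified Lean document; each statement's English description precedes it below -/
import Mathlib

section
/- Let d ≥ 1, let q be a prime, and let ε > 0. Then for almost all d-tuples of coefficient sequences (a_{j,k})_{k≥1} ∈ Z_q^{ℕ}, 1 ≤ j ≤ d, with respect to the product probability measure under which all coefficients a_{j,k} are independent and uniformly distributed on Z_q (this measure corresponds to the d-fold Haar measure on (Z_q((x^{−1})))^d restricted to fractional parts), the digital Kronecker sequence S(f) generated by f = (f_1,…,f_d) with f_j = Σ_{k≥1} a_{j,k} x^{−k} has star discrepancy satisfying: there exists C > 0 with D_N*(S(f)) ≤ C · (log N)^d (log log N)^{2+ε} / N for all N ≥ 3. -/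
open MeasureTheory Real

instance (n : ℕ) : MeasurableSpace (ZMod n) := ⊤

/-- The star discrepancy of the first `N` points of a sequence `z` in `[0,1)^ι`. -/
noncomputable def starDisc {ι : Type*} [Fintype ι] (z : ℕ → ι → ℝ) (N : ℕ) : ℝ :=
  sSup { r : ℝ | ∃ v : ι → ℝ,
    (∀ i, 0 < v i ∧ v i ≤ 1) ∧
    r = |(Nat.card {n : ℕ // n < N ∧ ∀ i, 0 ≤ z n i ∧ z n i < v i} : ℝ) / N
          - ∏ i, v i| }

/-- The digital Kronecker sequence generated by `f = (f_1, …, f_d)` with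
`f_j = ∑_{k≥1} a j (k-1) · x^{-k}` (so `a j k` is the coefficient of `x^{-(k+1)}`):
the coefficient of `x^{-(m+1)}` of the fractional part of `n(x)·f_j(x)` is
`∑_i n_i · a j (m+i)`, and the `j`-th coordinate of the `n`-th point is this
Laurent series evaluated at `x = q`. -/
noncomputable def digitalKronecker {q : ℕ} (d : ℕ) (a : Fin d → ℕ → ZMod q)
    (n : ℕ) : Fin d → ℝ :=
  fun j => ∑' m : ℕ,
    ((∑ i ∈ Finset.range (Nat.digits q n).length,
        ((Nat.digits q n).getD i 0 : ZMod q) * a j (m + i)).val : ℝ) / (q : ℝ) ^ (m + 1)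

open Finset in
/-- The base-`q` expansion of `v ∈ (0,1]` with infinitely many nonzero digits, recorded through
the integers formed by its first `k` digits. -/
theorem exists_nat_expansion {q : ℕ} (hq : 2 ≤ q) {v : ℝ} (hv0 : 0 < v) (hv1 : v ≤ 1) :
    ∃ u : ℕ → ℕ, u 0 = 0 ∧ (∀ k, q * u k ≤ u (k + 1) ∧ u (k + 1) < q * u k + q) ∧
      (∀ k, u k < q ^ k) ∧ ∀ k, (u k : ℝ) < q ^ k * v ∧ (q : ℝ) ^ k * v ≤ u k + 1 := by
  have hq0 : (0 : ℝ) < q := by positivity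
  have key : ∀ k : ℕ, ∃ m : ℕ, (m : ℝ) < q ^ k * v ∧ (q : ℝ) ^ k * v ≤ m + 1 := by
    intro k
    have hpos : 0 < (q : ℝ) ^ k * v := by positivity
    have hc : 0 < ⌈(q : ℝ) ^ k * v⌉₊ := Nat.ceil_pos.2 hpos
    refine ⟨⌈(q : ℝ) ^ k * v⌉₊ - 1, Nat.lt_ceil.1 (by omega), ?_⟩
    have := Nat.le_ceil ((q : ℝ) ^ k * v)
    rwa [← Nat.cast_add_one, Nat.sub_add_cancel hc]
  choose u hu1 hu2 using key
  have hlt : ∀ k, u k < q ^ k := fun k ↦ by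
    have h : (u k : ℝ) < (q : ℝ) ^ k :=
      (hu1 k).trans_le (mul_le_of_le_one_right (by positivity) hv1)
    exact_mod_cast h
  refine ⟨u, by simpa using hlt 0, fun k ↦ ⟨?_, ?_⟩, hlt, fun k ↦ ⟨hu1 k, hu2 k⟩⟩
  · have h : ((q * u k : ℕ) : ℝ) < ((u (k + 1) + 1 : ℕ) : ℝ) := by
      push_cast
      calc (q : ℝ) * u k < q * (q ^ k * v) := by gcongr; exact hu1 k
        _ = q ^ (k + 1) * v := by ring
        _ ≤ _ := hu2 (k + 1)
    have : q * u k < u (k + 1) + 1 := by exact_mod_cast h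
    omega
  · have h : ((u (k + 1) : ℕ) : ℝ) < ((q * u k + q : ℕ) : ℝ) := by
      push_cast
      calc (u (k + 1) : ℝ) < q ^ (k + 1) * v := hu1 (k + 1)
        _ = q * (q ^ k * v) := by ring
        _ ≤ q * (u k + 1) := by gcongr; exact hu2 k
        _ = _ := by ring
    exact_mod_cast h

open Finset in
/-- A half-open initial interval is a disjoint union of elementary intervals. -/
theorem card_lt_eq_sum_card_eq {κ : Type*} (F : Finset κ) (t : κ → ℕ → ℕ) (q : ℕ) (u : ℕ → ℕ)
    (ht : ∀ n k, q * t n k ≤ t n (k + 1) ∧ t n (k + 1) < q * t n k + q)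
    (hu0 : u 0 = 0) (hu : ∀ k, q * u k ≤ u (k + 1) ∧ u (k + 1) < q * u k + q) (R : ℕ) :
    #{n ∈ F | t n R < u R} =
      ∑ k ∈ range R, ∑ b ∈ Ico (q * u k) (u (k + 1)), #{n ∈ F | t n (k + 1) = b} := by
  classical
  induction R with
  | zero => simp [hu0]
  | succ R ih =>
    rw [sum_range_succ, ← ih, sum_card_fiberwise_eq_card_filter, ← card_union_of_disjoint]
    · congr 1
      ext n
      simp only [mem_filter, mem_union, mem_Ico, ← and_or_left]
      refine and_congr_right fun _ ↦ ?_
      have h1 := ht n R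
      have h2 := hu R
      have h3 : t n R < u R → q * t n R + q ≤ q * u R := fun h ↦ by
        rw [← Nat.mul_succ]; exact Nat.mul_le_mul_left _ h
      have h4 : u R ≤ t n R → q * u R ≤ q * t n R := fun h ↦ Nat.mul_le_mul_left _ h
      rcases lt_or_ge (t n R) (u R) with h | h
      · have := h3 h; omega
      · have := h4 h; omega
    · rw [disjoint_filter]
      intro n _ h
      have h1 := ht n R
      have h3 : q * t n R + q ≤ q * u R := by
        rw [← Nat.mul_succ]; exact Nat.mul_le_mul_left _ h
      simp only [mem_Ico]
      omega

/-- The resolution vectors of total level at most `r`. -/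
def levels (ι : Type*) [Fintype ι] [DecidableEq ι] (r : ℕ) : Finset (ι → ℕ) :=
  {l ∈ Fintype.piFinset fun _ ↦ Finset.range (r + 1) | ∑ i, l i ≤ r}

theorem mem_levels {ι : Type*} [Fintype ι] [DecidableEq ι] {r : ℕ} {l : ι → ℕ} :
    l ∈ levels ι r ↔ ∑ i, l i ≤ r := by
  simp only [levels, Finset.mem_filter, Fintype.mem_piFinset, Finset.mem_range,
    and_iff_right_iff_imp]
  exact fun h i ↦ Nat.lt_succ_of_le ((Finset.single_le_sum (fun _ _ ↦ Nat.zero_le _)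
    (Finset.mem_univ i)).trans h)

open Finset in
/-- If elementary boxes of total level at most `r` have local discrepancies at most `D`, then a box
that is anchored in the directions of `S` and elementary in the other directions has local
discrepancy at most the corresponding sum over resolutions. -/
theorem abs_card_box_sub_le {ι κ : Type*} [Fintype ι] [DecidableEq ι] {q : ℕ} (hq : 2 ≤ q) (r : ℕ)
    (X : Finset κ) (x : κ → ι → ℝ) (t : κ → ι → ℕ → ℕ) (ht0 : ∀ n i, t n i 0 = 0)
    (ht : ∀ n i k, q * t n i k ≤ t n i (k + 1) ∧ t n i (k + 1) < q * t n i k + q)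
    (hx : ∀ n i k, (t n i k : ℝ) ≤ q ^ k * x n i ∧ (q : ℝ) ^ k * x n i ≤ t n i k + 1)
    (D : (ι → ℕ) → ℝ) (hD0 : ∀ l, 0 ≤ D l)
    (hD : ∀ l, ∑ i, l i ≤ r → ∀ p : ι → ℕ, (∀ i, p i < q ^ l i) →
      |(#{n ∈ X | ∀ i, t n i (l i) = p i} : ℝ) - q ^ r / q ^ (∑ i, l i)| ≤ D l)
    (v : ι → ℝ) (hv : ∀ i, 0 < v i ∧ v i ≤ 1) (S : Finset ι) :
    ∀ l : ι → ℕ, ∑ i, l i ≤ r → (∀ i ∈ S, l i = 0) → ∀ p : ι → ℕ, (∀ i, p i < q ^ l i) →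
      |(#{n ∈ X | (∀ i ∈ S, x n i < v i) ∧ ∀ i, t n i (l i) = p i} : ℝ)
          - q ^ r / q ^ (∑ i, l i) * ∏ i ∈ S, v i| ≤
        q ^ #S * ∑ l' ∈ levels ι r with ∀ i, i ∉ S → l' i = l i,
          (D l' + if ∑ i, l' i = r then 1 else 0) := by
  classical
  have hq0 : (0 : ℝ) < q := by positivity
  have hq1 : (1 : ℝ) ≤ q := by exact_mod_cast (by omega : 1 ≤ q)
  have hw : ∀ l', 0 ≤ D l' + if ∑ i, l' i = r then (1 : ℝ) else 0 := fun l' ↦ by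
    have := hD0 l'; positivity
  induction S using Finset.induction_on with
  | empty =>
    intro l hl _ p hp
    have hfil : {l' ∈ levels ι r | ∀ i, i ∉ (∅ : Finset ι) → l' i = l i} = {l} := by
      ext l'
      simp only [mem_filter, mem_levels, mem_singleton, notMem_empty, not_false_eq_true,
        forall_const, ← funext_iff]
      exact ⟨fun h ↦ h.2, fun h ↦ ⟨h ▸ hl, h⟩⟩
    rw [hfil]
    simp only [notMem_empty, false_imp_iff, implies_true, true_and, prod_empty, mul_one, card_empty,
      pow_zero, one_mul, sum_singleton]
    refine (hD l hl p hp).trans (le_add_of_nonneg_right ?_)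
    positivity
  | insert j S hj ih =>
    intro l hl hlS p hp
    set L := ∑ i, l i with hL
    have hlj : l j = 0 := hlS j (mem_insert_self _ _)
    have hpj : p j = 0 := by simpa [hlj] using hp j
    obtain ⟨u, hu0, hu, huq, huv⟩ := exists_nat_expansion hq (hv j).1 (hv j).2
    obtain ⟨R, hR⟩ : ∃ R, r = L + R := ⟨r - L, by omega⟩
    set F := {n ∈ X | (∀ i ∈ S, x n i < v i) ∧ ∀ i, t n i (l i) = p i} with hF
    set w : (ι → ℕ) → ℝ := fun l' ↦ D l' + if ∑ i, l' i = r then (1 : ℝ) else 0 with hwdef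
    set V : ℝ := q ^ r / q ^ L * ∏ i ∈ S, v i with hV
    have hsum : ∀ k, ∑ i, Function.update l j k i = L + k := fun k ↦ by
      rw [sum_update_of_mem (mem_univ j), hL, ← add_sum_erase _ _ (mem_univ j), hlj,
        sdiff_singleton_eq_erase]
      omega
    have hcount : ∀ k b, #{n ∈ F | t n j k = b} = #{n ∈ X | (∀ i ∈ S, x n i < v i) ∧
        ∀ i, t n i (Function.update l j k i) = Function.update p j b i} := by
      intro k b
      rw [hF, filter_filter]
      congr 1
      refine filter_congr fun n _ ↦ ?_
      rw [and_assoc]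
      refine and_congr_right fun _ ↦ ⟨fun h i ↦ ?_, fun h ↦ ⟨fun i ↦ ?_, by simpa using h j⟩⟩
      · rcases eq_or_ne i j with rfl | hi
        · simpa using h.2
        · simpa [hi] using h.1 i
      · rcases eq_or_ne i j with rfl | hi
        · rw [hlj, hpj, ht0]
        · simpa [hi] using h i
    have hpu : ∀ k b, b < q ^ k → ∀ i, Function.update p j b i < q ^ Function.update l j k i := by
      intro k b hb i
      rcases eq_or_ne i j with rfl | hi
      · simpa using hb
      · simpa [hi] using hp i
    have hul : ∀ k, ∀ i ∈ S, Function.update l j k i = 0 := fun k i hi ↦ by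
      rw [Function.update_of_ne (by rintro rfl; exact hj hi)]
      exact hlS i (mem_insert_of_mem hi)
    have hVk : ∀ k, (q : ℝ) ^ r / q ^ (∑ i, Function.update l j k i) * ∏ i ∈ S, v i = V / q ^ k := by
      intro k
      rw [hsum, hV, pow_add]
      field_simp
    -- the discrepancy of each elementary piece
    have hpiece : ∀ k < R, ∀ b < q ^ (k + 1),
        |(#{n ∈ F | t n j (k + 1) = b} : ℝ) - V / q ^ (k + 1)| ≤
          q ^ #S * ∑ l' ∈ levels ι r with ∀ i, i ∉ S → l' i = Function.update l j (k + 1) i, w l' := by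
      intro k hk b hb
      have := ih (Function.update l j (k + 1)) (by rw [hsum]; omega) (hul _)
        (Function.update p j b) (hpu _ _ hb)
      rwa [← hcount, hVk] at this
    -- the boundary piece
    have hbd : (#{n ∈ F | t n j R = u R} : ℝ) ≤ w (Function.update l j R) := by
      have h := hD (Function.update l j R) (by rw [hsum]; omega)
        (Function.update p j (u R)) (hpu _ _ (huq R))
      have h1 : (#{n ∈ F | t n j R = u R} : ℝ) ≤
          #{n ∈ X | ∀ i, t n i (Function.update l j R i) = Function.update p j (u R) i} := by
        rw [hcount]
        refine Nat.cast_le.2 (card_le_card fun n hn ↦ ?_)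
        rw [mem_filter] at hn ⊢
        exact ⟨hn.1, hn.2.2⟩
      rw [hsum, ← hR, div_self (by positivity)] at h
      have h2 := (abs_le.1 h).2
      simp only [hwdef, hsum, ← hR, if_true]
      linarith
    have hVq : 0 ≤ V / q ^ R ∧ V / q ^ R ≤ 1 := by
      have hprod : ∏ i ∈ S, v i ≤ 1 := prod_le_one (fun i _ ↦ (hv i).1.le) fun i _ ↦ (hv i).2
      have hprod0 : 0 ≤ ∏ i ∈ S, v i := prod_nonneg fun i _ ↦ (hv i).1.le
      have : V / q ^ R = ∏ i ∈ S, v i := by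
        rw [hV, hR, pow_add]; field_simp
      rw [this]
      exact ⟨hprod0, hprod⟩
    have hbd_nonneg : 1 ≤ w (Function.update l j R) := by
      simp only [hwdef, hsum, ← hR, if_true]
      linarith [hD0 (Function.update l j R)]
    -- sandwich of the count
    set c := #{n ∈ X | (∀ i ∈ insert j S, x n i < v i) ∧ ∀ i, t n i (l i) = p i} with hc
    have hc' : c = #{n ∈ F | x n j < v j} := by
      rw [hc, hF, filter_filter]
      congr 1
      refine filter_congr fun n _ ↦ ?_
      rw [forall_mem_insert]
      tauto
    have hlow : #{n ∈ F | t n j R < u R} ≤ c := by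
      rw [hc']
      refine card_le_card (monotone_filter_right _ fun n _ h ↦ ?_)
      have h1 := (hx n j R).2
      have h2 := (huv R).1
      have h3 : (t n j R : ℝ) + 1 ≤ u R := by exact_mod_cast h
      exact lt_of_mul_lt_mul_left ((h1.trans h3).trans_lt h2) (by positivity)
    have hup : c ≤ #{n ∈ F | t n j R < u R} + #{n ∈ F | t n j R = u R} := by
      rw [hc']
      refine (card_le_card fun n hn ↦ ?_).trans (card_union_le _ _)
      simp only [mem_union, mem_filter, ← and_or_left] at hn ⊢
      refine ⟨hn.1, ?_⟩
      have h1 := (hx n j R).1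
      have h2 := (huv R).2
      have h3 : (q : ℝ) ^ R * x n j < q ^ R * v j := mul_lt_mul_of_pos_left hn.2 (by positivity)
      have h4 : (t n j R : ℝ) < u R + 1 := by linarith
      have h5 : t n j R < u R + 1 := by exact_mod_cast h4
      omega
    have hsumeq := card_lt_eq_sum_card_eq F (fun n ↦ t n j) q u (fun n ↦ ht n j) hu0 hu R
    -- telescoping of the volumes
    have hvol : ∀ R : ℕ, ∑ k ∈ range R, ∑ _b ∈ Ico (q * u k) (u (k + 1)), V / q ^ (k + 1) =
        V * u R / q ^ R := by
      intro R
      induction R with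
      | zero => simp [hu0]
      | succ R ihR =>
        rw [sum_range_succ, ihR, sum_const, Nat.card_Ico, nsmul_eq_mul, Nat.cast_sub (hu R).1]
        push_cast
        field_simp
        ring
    set G := ∑ l' ∈ levels ι r with ∀ i, i ∉ insert j S → l' i = l i, w l' with hG
    have hmain : |(#{n ∈ F | t n j R < u R} : ℝ) - V * u R / q ^ R| ≤ (q - 1) * q ^ #S * G := by
      rw [hsumeq, ← hvol]
      push_cast
      rw [← sum_sub_distrib]
      refine (abs_sum_le_sum_abs _ _).trans ?_
      calc _ ≤ ∑ k ∈ range R, (q - 1) * (q ^ #S * ∑ l' ∈ levels ι r with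
              ∀ i, i ∉ S → l' i = Function.update l j (k + 1) i, w l') := by
            refine sum_le_sum fun k hk ↦ ?_
            rw [← sum_sub_distrib]
            refine (abs_sum_le_sum_abs _ _).trans ?_
            refine (sum_le_card_nsmul _ _ _ fun b hb ↦ hpiece k (mem_range.1 hk) b
              ((mem_Ico.1 hb).2.trans (huq _))).trans ?_
            rw [nsmul_eq_mul]
            refine mul_le_mul_of_nonneg_right ?_
              (mul_nonneg (by positivity) (sum_nonneg fun _ _ ↦ hw _))
            rw [Nat.card_Ico, le_sub_iff_add_le]
            exact_mod_cast (by have := hu k; omega)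
        _ = (q - 1) * q ^ #S * ∑ l' ∈ (range R).biUnion fun k ↦ {l' ∈ levels ι r |
              ∀ i, i ∉ S → l' i = Function.update l j (k + 1) i}, w l' := by
            rw [sum_biUnion, ← mul_sum, ← mul_sum, mul_assoc]
            intro k _ k' _ hkk'
            refine disjoint_left.2 fun l' h h' ↦ hkk' ?_
            have h1 := (mem_filter.1 h).2 j hj
            have h2 := (mem_filter.1 h').2 j hj
            simp only [Function.update_self] at h1 h2
            omega
        _ ≤ _ := by
            refine mul_le_mul_of_nonneg_left (sum_le_sum_of_subset_of_nonneg ?_ fun _ _ _ ↦ hw _)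
              (mul_nonneg (by linarith) (by positivity))
            intro l' h
            simp only [mem_biUnion, mem_filter, mem_insert, not_or] at h ⊢
            obtain ⟨k, _, h1, h2⟩ := h
            refine ⟨h1, fun i hi ↦ ?_⟩
            rw [h2 i hi.2, Function.update_of_ne hi.1]
    have hbdG : w (Function.update l j R) ≤ q ^ #S * G := by
      have h1 : w (Function.update l j R) ≤ G := by
        refine single_le_sum (f := w) (fun l' _ ↦ hw l') (mem_filter.2 ⟨?_, fun i hi ↦ ?_⟩)
        · rw [mem_levels, hsum]; omega
        · rw [mem_insert, not_or] at hi
          rw [Function.update_of_ne hi.1]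
      exact h1.trans (le_mul_of_one_le_left (sum_nonneg fun _ _ ↦ hw _) (one_le_pow₀ hq1))
    have hvj : 0 ≤ V * v j - V * u R / q ^ R ∧ V * v j - V * u R / q ^ R ≤ 1 := by
      have h1 := (huv R).1
      have h2 := (huv R).2
      have h3 : V * v j - V * u R / q ^ R = V / q ^ R * (q ^ R * v j - u R) := by
        field_simp
      rw [h3]
      exact ⟨mul_nonneg hVq.1 (by linarith), mul_le_one₀ hVq.2 (by linarith) (by linarith)⟩
    have hlow' : (#{n ∈ F | t n j R < u R} : ℝ) ≤ c := by exact_mod_cast hlow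
    have hup' : (c : ℝ) ≤ #{n ∈ F | t n j R < u R} + #{n ∈ F | t n j R = u R} := by
      exact_mod_cast hup
    rw [prod_insert hj, card_insert_of_notMem hj, mul_comm (v j), ← mul_assoc, ← hV, pow_succ]
    have hm := abs_le.1 hmain
    rw [abs_le]
    constructor <;> nlinarith [hm.1, hm.2, hvj.1, hvj.2]

open Finset in
/-- The fibres of a homomorphism of finite groups deviate from the average by at most the excess of
the kernel, and this excess vanishes or is at least the average. -/
theorem card_fiber_addMonoidHom {G H : Type*} [AddCommGroup G] [AddCommGroup H] [Fintype G]
    [Fintype H] [DecidableEq H] (φ : G →+ H) {s : ℕ}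
    (hs : Fintype.card G = s * Fintype.card H) :
    (#{g | φ g = 0} = s ∨ 2 * s ≤ #{g | φ g = 0}) ∧
      ∀ h, |(#{g | φ g = h} : ℝ) - s| ≤ #{g | φ g = 0} - s := by
  classical
  set K := #{g | φ g = 0} with hK
  set I := #(univ.image φ) with hI
  have hfib : ∀ h, #{g | φ g = h} = 0 ∨ #{g | φ g = h} = K := by
    intro h
    by_cases hh : h ∈ Set.range φ
    · exact Or.inr (AddMonoidHom.card_fiber_eq_of_mem_range φ hh ⟨0, map_zero φ⟩)
    · refine Or.inl (card_eq_zero.2 (filter_eq_empty_iff.2 fun g _ hg ↦ hh ⟨g, hg⟩))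
  have hG : Fintype.card G = I * K := by
    rw [← card_univ, card_eq_sum_card_image φ, ← smul_eq_mul, ← sum_const]
    refine sum_congr rfl fun h hh ↦ ?_
    obtain ⟨g, -, hg⟩ := mem_image.1 hh
    exact AddMonoidHom.card_fiber_eq_of_mem_range φ ⟨g, hg⟩ ⟨0, map_zero φ⟩
  have hdvd : I ∣ Fintype.card H := by
    have h := AddSubgroup.card_addSubgroup_dvd_card φ.range
    have e : Nat.card φ.range = I := by
      rw [hI, ← Set.ncard_coe_finset, coe_image, coe_univ, Set.image_univ, ← AddMonoidHom.coe_range]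
      rfl
    rwa [e, Nat.card_eq_fintype_card] at h
  obtain ⟨c, hc⟩ := hdvd
  have hI0 : 0 < I := card_pos.2 ⟨φ 0, mem_image_of_mem _ (mem_univ _)⟩
  have hKs : K = s * c := by
    have : I * K = I * (s * c) := by rw [← hG, hs, hc]; ring
    exact Nat.eq_of_mul_eq_mul_left hI0 this
  have hc0 : 0 < c := Nat.pos_of_ne_zero fun h ↦ by
    rw [h, mul_zero] at hc
    exact Fintype.card_ne_zero hc
  have hdich : K = s ∨ 2 * s ≤ K := by
    rcases (Nat.succ_le_of_lt hc0).eq_or_lt with h | h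
    · left; rw [hKs, ← h]; simp
    · right; rw [hKs, mul_comm]; exact Nat.mul_le_mul_left _ h
  refine ⟨hdich, fun h ↦ ?_⟩
  have hKR : (K : ℝ) = s ∨ (2 : ℝ) * s ≤ K := by exact_mod_cast hdich
  by_cases hc1 : c = 1
  · have hI1 : univ.image φ = univ := by
      rw [← card_eq_iff_eq_univ, hc, hc1, mul_one]
    obtain ⟨g, -, hg⟩ := mem_image.1 (hI1 ▸ mem_univ h : h ∈ univ.image φ)
    have : #{g | φ g = h} = K :=
      AddMonoidHom.card_fiber_eq_of_mem_range φ ⟨g, hg⟩ ⟨0, map_zero φ⟩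
    rw [this, hKs, hc1]
    simp
  · have h2 : (2 : ℝ) * s ≤ K := by
      have : 2 * s ≤ K := by
        rw [hKs, mul_comm]; exact Nat.mul_le_mul_left _ (by omega)
      exact_mod_cast this
    have hs0 : (0 : ℝ) ≤ s := Nat.cast_nonneg _
    rcases hfib h with h | h <;> rw [h, abs_le] <;> constructor <;> push_cast <;> linarith

open Finset in
/-- The number of digit vectors of length `r` whose images under the leading `l j × r` blocks of all
generating matrices vanish. -/
def kernelCard {q d : ℕ} [NeZero q] (a : Fin d → ℕ → ZMod q) (r : ℕ) (l : Fin d → ℕ) : ℕ :=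
  #{y : Fin r → ZMod q | ∀ j, ∀ m < l j, ∑ i, y i * a j (m + i) = 0}

/-- The excess of `kernelCard` over its value for a surjective system. -/
def kernelExcess {q d : ℕ} [NeZero q] (a : Fin d → ℕ → ZMod q) (r : ℕ) (l : Fin d → ℕ) : ℕ :=
  kernelCard a r l - q ^ (r - ∑ j, l j)

open Finset in
theorem kernelExcess_spec {q d : ℕ} [NeZero q] (a : Fin d → ℕ → ZMod q) {r : ℕ}
    {l : Fin d → ℕ} (hl : ∑ j, l j ≤ r) :
    kernelCard a r l = kernelExcess a r l + q ^ (r - ∑ j, l j) ∧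
      (kernelExcess a r l = 0 ∨ q ^ (r - ∑ j, l j) ≤ kernelExcess a r l) ∧
      ∀ h : Fin d → ℕ → ZMod q,
        |(#{y : Fin r → ZMod q | ∀ j, ∀ m < l j, ∑ i, y i * a j (m + i) = h j m} : ℝ)
          - q ^ r / q ^ (∑ j, l j)| ≤ kernelExcess a r l := by
  let φ : (Fin r → ZMod q) →+ ((p : Σ j, Fin (l j)) → ZMod q) :=
    { toFun := fun y p ↦ ∑ i, y i * a p.1 (p.2 + i)
      map_zero' := by ext; simp
      map_add' := fun y z ↦ by ext; simp [add_mul, sum_add_distrib] }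
  have hφ : ∀ (h : Fin d → ℕ → ZMod q) y, φ y = (fun p ↦ h p.1 p.2) ↔
      ∀ j, ∀ m < l j, ∑ i, y i * a j (m + i) = h j m := by
    intro h y
    rw [funext_iff]
    exact ⟨fun H j m hm ↦ H ⟨j, m, hm⟩, fun H p ↦ H p.1 p.2 p.2.2⟩
  have hq : (q : ℝ) ≠ 0 := NeZero.ne _
  obtain ⟨h1, h2⟩ := card_fiber_addMonoidHom φ (s := q ^ (r - ∑ j, l j)) (by
    simp only [Fintype.card_pi, ZMod.card, prod_const, card_univ, Fintype.card_fin,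
      Fintype.card_sigma]
    rw [← pow_add, Nat.sub_add_cancel hl])
  have hK : #{g | φ g = 0} = kernelCard a r l := by
    rw [kernelCard]
    congr 1
    exact filter_congr fun y _ ↦ hφ 0 y
  rw [hK] at h1 h2
  have hle : q ^ (r - ∑ j, l j) ≤ kernelCard a r l := by omega
  have e : kernelCard a r l = kernelExcess a r l + q ^ (r - ∑ j, l j) := by
    rw [kernelExcess, Nat.sub_add_cancel hle]
  refine ⟨e, by omega, fun h ↦ ?_⟩
  have := h2 fun p ↦ h p.1 p.2
  rw [filter_congr fun y _ ↦ hφ h y, e] at this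
  push_cast at this
  rwa [add_sub_cancel_right, pow_sub₀ _ hq hl, ← div_eq_mul_inv] at this

/-- The integer formed by the first `k` digits of a sequence. -/
def digitPrefix {q : ℕ} (e : ℕ → ZMod q) : ℕ → ℕ
  | 0 => 0
  | k + 1 => q * digitPrefix e k + (e k).val

theorem digitPrefix_succ_bounds {q : ℕ} [NeZero q] (e : ℕ → ZMod q) (k : ℕ) :
    q * digitPrefix e k ≤ digitPrefix e (k + 1) ∧
      digitPrefix e (k + 1) < q * digitPrefix e k + q := by
  have := ZMod.val_lt (e k)
  simp only [digitPrefix]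
  omega

theorem exists_digitPrefix_eq_iff {q : ℕ} [NeZero q] (k p : ℕ) (hp : p < q ^ k) :
    ∃ h : ℕ → ZMod q, ∀ e : ℕ → ZMod q, digitPrefix e k = p ↔ ∀ m < k, e m = h m := by
  have hq : 0 < q := NeZero.pos q
  induction k generalizing p with
  | zero => exact ⟨0, fun e ↦ by simpa [digitPrefix, eq_comm] using hp⟩
  | succ k ih =>
    obtain ⟨h, hh⟩ := ih (p / q) (Nat.div_lt_of_lt_mul (by rwa [← pow_succ']))
    refine ⟨Function.update h k ((p % q : ℕ) : ZMod q), fun e ↦ ?_⟩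
    have hlt := ZMod.val_lt (e k)
    have hval : e k = ((p % q : ℕ) : ZMod q) ↔ (e k).val = p % q := by
      constructor
      · intro H; rw [H, ZMod.val_cast_of_lt (Nat.mod_lt _ hq)]
      · intro H; rw [← H, ZMod.natCast_zmod_val]
    have h1 : digitPrefix e (k + 1) = p ↔ digitPrefix e k = p / q ∧ (e k).val = p % q := by
      simp only [digitPrefix]
      constructor
      · rintro rfl
        rw [Nat.mul_add_div hq, Nat.div_eq_of_lt hlt, Nat.mul_add_mod, Nat.mod_eq_of_lt hlt]
        simp
      · rintro ⟨h1, h2⟩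
        rw [h1, h2, Nat.div_add_mod]
    rw [h1, hh, ← hval]
    constructor
    · rintro ⟨h1, h2⟩ m hm
      rcases (Nat.lt_succ_iff.1 hm).lt_or_eq with h | rfl
      · rw [Function.update_of_ne h.ne, h1 m h]
      · rw [Function.update_self, h2]
    · intro H
      refine ⟨fun m hm ↦ ?_, by simpa using H k (Nat.lt_succ_self k)⟩
      rw [H m (by omega), Function.update_of_ne hm.ne]

theorem digitPrefix_le_tsum {q : ℕ} [NeZero q] (e : ℕ → ZMod q) (k : ℕ) :
    (digitPrefix e k : ℝ) ≤ q ^ k * ∑' m, ((e m).val : ℝ) / q ^ (m + 1) ∧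
      (q : ℝ) ^ k * ∑' m, ((e m).val : ℝ) / q ^ (m + 1) ≤ digitPrefix e k + 1 := by
  have hq : (q : ℝ) ≠ 0 := NeZero.ne _
  let f : ℕ → Fin q := fun m ↦ ⟨(e m).val, ZMod.val_lt _⟩
  have h1 : ∑' m, ((e m).val : ℝ) / q ^ (m + 1) = Real.ofDigits f := by
    simp only [Real.ofDigits, Real.ofDigitsTerm, div_eq_mul_inv, f]
  have h2 : ∀ k, (q : ℝ) ^ k * ∑ i ∈ Finset.range k, Real.ofDigitsTerm f i = digitPrefix e k := by
    intro k
    induction k with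
    | zero => simp [digitPrefix]
    | succ k ih =>
      rw [Finset.sum_range_succ, mul_add, pow_succ', mul_assoc, ih]
      simp only [digitPrefix, Real.ofDigitsTerm, f]
      push_cast
      field_simp
      ring
  rw [h1, Real.ofDigits_eq_sum_add_ofDigits f k, mul_add, h2, mul_inv_cancel_left₀ (by positivity)]
  exact ⟨le_add_of_nonneg_right (Real.ofDigits_nonneg _),
    by gcongr; exact Real.ofDigits_le_one _⟩

/-- The digit sequence `m ↦ ∑ᵢ nᵢ b (m + i)` attached to `n` and a coefficient sequence `b`. -/
def kroneckerDigit {q : ℕ} (b : ℕ → ZMod q) (n m : ℕ) : ZMod q :=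
  ∑ i ∈ Finset.range (Nat.digits q n).length, ((Nat.digits q n).getD i 0 : ZMod q) * b (m + i)

open Finset in
theorem kroneckerDigit_eq_sum {q : ℕ} (hq : 2 ≤ q) (b : ℕ → ZMod q) {n B : ℕ} (hn : n < q ^ B)
    (m : ℕ) :
    kroneckerDigit b n m = ∑ i ∈ range B, ((n / q ^ i % q : ℕ) : ZMod q) * b (m + i) := by
  have hlen : (Nat.digits q n).length ≤ B := (Nat.digits_length_le_iff hq n).2 hn
  rw [kroneckerDigit]
  simp only [← Nat.getD_digits n _ hq]
  refine sum_subset (range_subset_range.2 hlen) fun i _ hi ↦ ?_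
  rw [List.getD_eq_default _ _ (by simpa using hi)]
  simp

open Finset in
theorem kroneckerDigit_block {q : ℕ} (hq : 2 ≤ q) (b : ℕ → ZMod q) (A : ℕ) {r n : ℕ}
    (hn : n < q ^ r) (m : ℕ) :
    kroneckerDigit b (A * q ^ r + n) m =
      ∑ i : Fin r, ((n / q ^ (i : ℕ) % q : ℕ) : ZMod q) * b (m + i) +
        kroneckerDigit b A (m + r) := by
  have hq0 : 0 < q := by omega
  have hr : 0 < q ^ r := by positivity
  set B := (Nat.digits q A).length
  have hA : A < q ^ B := Nat.lt_base_pow_length_digits hq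
  have hlt : A * q ^ r + n < q ^ (r + B) := by
    calc A * q ^ r + n < A * q ^ r + q ^ r := by omega
      _ = (A + 1) * q ^ r := by ring
      _ ≤ q ^ B * q ^ r := Nat.mul_le_mul_right _ hA
      _ = _ := by ring
  rw [kroneckerDigit_eq_sum hq b hlt, kroneckerDigit_eq_sum hq b hA, sum_range_add,
    Fin.sum_univ_eq_sum_range (fun i ↦ ((n / q ^ i % q : ℕ) : ZMod q) * b (m + i))]
  congr 1
  · refine sum_congr rfl fun i hi ↦ ?_
    obtain ⟨k, rfl⟩ : ∃ k, r = i + (k + 1) := ⟨r - i - 1, by have := mem_range.1 hi; omega⟩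
    have : A * q ^ (i + (k + 1)) + n = q ^ i * (q * (A * q ^ k)) + n := by ring
    rw [this, Nat.mul_add_div (by positivity), Nat.mul_add_mod]
  · refine sum_congr rfl fun i _ ↦ ?_
    rw [pow_add, ← Nat.div_div_eq_div_mul, mul_comm A, Nat.mul_add_div hr, Nat.div_eq_of_lt hn,
      add_zero, add_assoc]

open Finset in
theorem card_filter_digits {q : ℕ} [NeZero q] (r : ℕ) (P : (Fin r → ZMod q) → Prop)
    [DecidablePred P] :
    #{n ∈ range (q ^ r) | P fun i ↦ ((n / q ^ (i : ℕ) % q : ℕ) : ZMod q)} = #{y | P y} := by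
  have hq : 0 < q := NeZero.pos q
  refine card_bij (fun n _ i ↦ ((n / q ^ (i : ℕ) % q : ℕ) : ZMod q)) ?_ ?_ ?_
  · intro n hn
    simpa using (mem_filter.1 hn).2
  · intro n hn n' hn' h
    have hn1 := mem_range.1 (mem_filter.1 hn).1
    have hn1' := mem_range.1 (mem_filter.1 hn').1
    have : finFunctionFinEquiv.symm ⟨n, hn1⟩ = finFunctionFinEquiv.symm ⟨n', hn1'⟩ := by
      ext i
      have := congrArg ZMod.val (congrFun h i)
      simpa [ZMod.val_cast_of_lt (Nat.mod_lt _ hq)] using this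
    simpa using this
  · intro y hy
    set n := finFunctionFinEquiv fun i ↦ (⟨(y i).val, ZMod.val_lt _⟩ : Fin q) with hn
    have key : (fun i : Fin r ↦ (((n : ℕ) / q ^ (i : ℕ) % q : ℕ) : ZMod q)) = y := by
      ext i
      have h : finFunctionFinEquiv.symm n i = (⟨(y i).val, ZMod.val_lt _⟩ : Fin q) := by
        rw [hn, Equiv.symm_apply_apply]
      have h' := congrArg Fin.val h
      rw [finFunctionFinEquiv_symm_apply_val] at h'
      simp only at h'
      rw [h', ZMod.natCast_zmod_val]
    refine ⟨n, ?_, key⟩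
    rw [mem_filter, key]
    exact ⟨mem_range.2 n.2, by simpa using hy⟩

/-- A bound for the local discrepancies of all `q`-adic blocks of length `q ^ r`. -/
def blockBound {q d : ℕ} [NeZero q] (a : Fin d → ℕ → ZMod q) (r : ℕ) : ℝ :=
  q ^ d * ∑ l ∈ levels (Fin d) r, (kernelExcess a r l + if ∑ i, l i = r then 1 else 0)

open Finset in
theorem abs_card_block_sub_le {q d : ℕ} [NeZero q] (hq : 2 ≤ q) (a : Fin d → ℕ → ZMod q)
    (r A : ℕ) (v : Fin d → ℝ) (hv : ∀ i, 0 < v i ∧ v i ≤ 1) :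
    |(#{n ∈ range (q ^ r) | ∀ i, digitalKronecker d a (A * q ^ r + n) i < v i} : ℝ)
      - q ^ r * ∏ i, v i| ≤ blockBound a r := by
  have hx : ∀ n i k,
      (digitPrefix (kroneckerDigit (a i) (A * q ^ r + n)) k : ℝ) ≤
        q ^ k * digitalKronecker d a (A * q ^ r + n) i ∧
      (q : ℝ) ^ k * digitalKronecker d a (A * q ^ r + n) i ≤
        digitPrefix (kroneckerDigit (a i) (A * q ^ r + n)) k + 1 :=
    fun n i k ↦ digitPrefix_le_tsum _ k
  have h := abs_card_box_sub_le hq r (range (q ^ r))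
    (fun n ↦ digitalKronecker d a (A * q ^ r + n))
    (fun n i ↦ digitPrefix (kroneckerDigit (a i) (A * q ^ r + n))) (fun _ _ ↦ rfl)
    (fun _ _ _ ↦ digitPrefix_succ_bounds _ _) hx (fun l ↦ kernelExcess a r l)
    (fun _ ↦ Nat.cast_nonneg _) ?_ v hv univ (fun _ ↦ 0) (by simp) (fun _ _ ↦ rfl) (fun _ ↦ 0)
    (by simp)
  · have hsub : ∀ n i, digitPrefix (kroneckerDigit (a i) (A * q ^ r + n)) 0 = 0 := fun _ _ ↦ rfl
    simpa [blockBound, hsub] using h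
  · intro l hl p hp
    choose h hh using fun i ↦ exists_digitPrefix_eq_iff (l i) (p i) (hp i)
    have := (kernelExcess_spec a hl).2.2 fun j m ↦ h j m - kroneckerDigit (a j) A (m + r)
    rw [← card_filter_digits] at this
    convert this using 5
    ext n
    simp only [mem_filter]
    refine and_congr_right fun hn ↦ forall_congr' fun i ↦ ?_
    rw [hh]
    refine forall₂_congr fun m _ ↦ ?_
    rw [kroneckerDigit_block hq _ _ (mem_range.1 hn), eq_sub_iff_add_eq]

open Finset in
theorem abs_card_sub_le_sum {q : ℕ} (hq : 2 ≤ q) (P : ℕ → Prop) [DecidablePred P] (V : ℝ)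
    (H : ℕ → ℝ)
    (hP : ∀ r A, |(#{n ∈ range (q ^ r) | P (A * q ^ r + n)} : ℝ) - q ^ r * V| ≤ H r)
    {N M : ℕ} (hN : N < q ^ M) :
    |(#{n ∈ range N | P n} : ℝ) - N * V| ≤ q * ∑ r ∈ range M, H r := by
  have hH : ∀ r, 0 ≤ H r := fun r ↦ (abs_nonneg _).trans (hP r 0)
  set E : ℕ → ℝ := fun n ↦ (#{k ∈ range n | P k} : ℝ) - n * V with hE
  have hstep : ∀ r A, |E ((A + 1) * q ^ r) - E (A * q ^ r)| ≤ H r := by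
    intro r A
    have h1 : #{k ∈ range ((A + 1) * q ^ r) | P k} =
        #{k ∈ range (A * q ^ r) | P k} + #{n ∈ range (q ^ r) | P (A * q ^ r + n)} := by
      simp only [card_filter]
      rw [add_mul, one_mul, sum_range_add]
    refine le_of_eq_of_le (congrArg _ ?_) (hP r A)
    simp only [hE, h1]
    push_cast
    ring
  have hsteps : ∀ r A c, |E ((A + c) * q ^ r) - E (A * q ^ r)| ≤ c * H r := by
    intro r A c
    induction c with
    | zero => simp
    | succ c ih =>
      have h1 := hstep r (A + c)
      rw [← add_assoc]
      push_cast
      calc _ ≤ _ := abs_sub_le _ (E ((A + c) * q ^ r)) _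
        _ ≤ (c + 1) * H r := by linarith
  have hdesc : ∀ M, |E N - E (N / q ^ M * q ^ M)| ≤ q * ∑ r ∈ range M, H r := by
    intro M
    induction M with
    | zero => simp
    | succ M ih =>
      have h1 : N / q ^ M = N / q ^ (M + 1) * q + N / q ^ M % q := by
        rw [pow_succ, ← Nat.div_div_eq_div_mul, Nat.div_add_mod']
      have h2 := hsteps M (N / q ^ (M + 1) * q) (N / q ^ M % q)
      rw [← h1, mul_assoc, ← pow_succ'] at h2
      have h3 : ((N / q ^ M % q : ℕ) : ℝ) * H M ≤ q * H M :=
        mul_le_mul_of_nonneg_right (Nat.cast_le.2 (Nat.mod_lt _ (by omega)).le) (hH M)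
      rw [sum_range_succ, mul_add]
      calc _ ≤ _ := abs_sub_le _ (E (N / q ^ M * q ^ M)) _
        _ ≤ _ := by linarith
  have h := hdesc M
  rw [Nat.div_eq_of_lt hN, zero_mul] at h
  simpa [hE] using h

open Finset in
/-- The star discrepancy of a digital Kronecker sequence is controlled by kernel excesses. -/
theorem starDisc_digitalKronecker_le {q d : ℕ} [NeZero q] (hq : 2 ≤ q) (a : Fin d → ℕ → ZMod q)
    {N M : ℕ} (hN0 : 0 < N) (hN : N < q ^ M) :
    starDisc (digitalKronecker d a) N ≤ q * (∑ r ∈ range M, blockBound a r) / N := by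
  have hN' : (0 : ℝ) < N := Nat.cast_pos.2 hN0
  have hb : ∀ r, 0 ≤ blockBound a r := fun r ↦
    (abs_nonneg _).trans (abs_card_block_sub_le hq a r 0 (fun _ ↦ 1) fun _ ↦ by simp)
  refine Real.sSup_le ?_ (by have := sum_nonneg fun r (_ : r ∈ range M) ↦ hb r; positivity)
  rintro _ ⟨v, hv, rfl⟩
  have hz : ∀ n i, 0 ≤ digitalKronecker d a n i := fun n i ↦ tsum_nonneg fun _ ↦ by positivity
  have hcard : Nat.card {n : ℕ // n < N ∧ ∀ i, 0 ≤ digitalKronecker d a n i ∧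
      digitalKronecker d a n i < v i} = #{n ∈ range N | ∀ i, digitalKronecker d a n i < v i} := by
    rw [← Nat.subtype_card]
    intro n
    simp [hz]
  have h := abs_card_sub_le_sum hq (fun n ↦ ∀ i, digitalKronecker d a n i < v i) (∏ i, v i)
    (blockBound a) (fun r A ↦ abs_card_block_sub_le hq a r A v hv) hN
  rw [hcard, le_div_iff₀ hN', ← abs_of_pos hN', ← abs_mul, abs_of_pos hN', sub_mul,
    div_mul_cancel₀ _ hN'.ne', mul_comm _ (N : ℝ)]
  exact h

open scoped ENNReal

instance (n : ℕ) : DiscreteMeasurableSpace (ZMod n) := ⟨fun _ ↦ trivial⟩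

section Probability

variable {q d : ℕ} [Fact q.Prime] {μ : Measure (Fin d → ℕ → ZMod q)}

open Finset in
/-- A fixed nonzero polynomial has all prescribed leading digits zero with the probability of
independent uniform digits. -/
theorem measure_kernel_le
    (hμ : ∀ (s : Finset (Fin d × ℕ)) (v : Fin d × ℕ → ZMod q),
      μ {a | ∀ p ∈ s, a p.1 p.2 = v p} = ((q : ENNReal))⁻¹ ^ s.card)
    {r : ℕ} (l : Fin d → ℕ) {y : Fin r → ZMod q} (hy : y ≠ 0) :
    μ {a | ∀ j, ∀ m < l j, ∑ i, y i * a j (m + i) = 0} ≤ (q : ℝ≥0∞)⁻¹ ^ (∑ j, l j) := by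
  have hq0 : (q : ℝ≥0∞) ≠ 0 := by exact_mod_cast (Fact.out : q.Prime).ne_zero
  obtain ⟨i₀, hi₀, htop⟩ : ∃ i₀, y i₀ ≠ 0 ∧ ∀ i, i₀ < i → y i = 0 := by
    obtain ⟨i, hi⟩ := Function.ne_iff.1 hy
    have hne : ({i | y i ≠ 0} : Finset (Fin r)).Nonempty := ⟨i, by simpa using hi⟩
    refine ⟨_, (mem_filter.1 (max'_mem _ hne)).2, fun k hk ↦ ?_⟩
    by_contra h
    exact absurd (le_max' {i | y i ≠ 0} k (by simpa using h)) (not_le.2 hk)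
  set Ev := {a : Fin d → ℕ → ZMod q | ∀ j, ∀ m < l j, ∑ i, y i * a j (m + i) = 0} with hEv
  let T : (Fin d → Fin i₀ → ZMod q) → Set (Fin d → ℕ → ZMod q) :=
    fun w ↦ {a | a ∈ Ev ∧ ∀ j (k : Fin i₀), a j k = w j k}
  have hT : ∀ w, μ (T w) ≤ (q : ℝ≥0∞)⁻¹ ^ (d * i₀ + ∑ j, l j) := by
    intro w
    rcases (T w).eq_empty_or_nonempty with h | ⟨a', ha', hw'⟩
    · simp [h]
    set s : Finset (Fin d × ℕ) := (univ.sigma fun j ↦ range (i₀ + l j)).map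
      (Equiv.sigmaEquivProd (Fin d) ℕ).toEmbedding with hs
    have hcard : #s = d * i₀ + ∑ j, l j := by
      simp [hs, sum_add_distrib]
    rw [← hcard, ← hμ s fun p ↦ a' p.1 p.2]
    refine measure_mono fun a ⟨ha, hw⟩ ↦ ?_
    have key : ∀ j k, k < i₀ + l j → a j k = a' j k := by
      intro j k
      induction k using Nat.strong_induction_on with
      | _ k ih =>
        intro hk
        rcases lt_or_ge k i₀ with hlt | hge
        · rw [hw j ⟨k, hlt⟩, ← hw' j ⟨k, hlt⟩]
        obtain ⟨m, rfl⟩ : ∃ m, k = m + i₀ := ⟨k - i₀, by omega⟩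
        have h0 : ∑ i, y i * (a j (m + i) - a' j (m + i)) = 0 := by
          simp only [mul_sub, sum_sub_distrib]
          rw [ha j m (by omega), ha' j m (by omega), sub_zero]
        rw [Fintype.sum_eq_single i₀] at h0
        · exact sub_eq_zero.1 ((mul_eq_zero.1 h0).resolve_left hi₀)
        · intro i hi
          rcases hi.lt_or_gt with h | h
          · rw [ih (m + i) (by have : (i : ℕ) < i₀ := h; omega)
              (by have : (i : ℕ) < i₀ := h; omega), sub_self, mul_zero]
          · rw [htop i h, zero_mul]
    rintro ⟨j, k⟩ hp
    refine key j k ?_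
    simpa [hs] using hp
  have hcover : Ev ⊆ ⋃ w, T w := fun a ha ↦
    Set.mem_iUnion.2 ⟨fun j k ↦ a j k, ha, fun _ _ ↦ rfl⟩
  calc μ Ev ≤ ∑ w, μ (T w) := (measure_mono hcover).trans (measure_iUnion_fintype_le μ T)
    _ ≤ ∑ _w : Fin d → Fin i₀ → ZMod q, (q : ℝ≥0∞)⁻¹ ^ (d * i₀ + ∑ j, l j) :=
      sum_le_sum fun w _ ↦ hT w
    _ = (q : ℝ≥0∞)⁻¹ ^ (∑ j, l j) := by
      rw [sum_const, card_univ]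
      simp only [Fintype.card_pi, ZMod.card, prod_const, card_univ, Fintype.card_fin, nsmul_eq_mul]
      push_cast
      rw [← pow_mul, pow_add, ← mul_assoc, mul_comm d, ← mul_pow,
        ENNReal.mul_inv_cancel hq0 (ENNReal.natCast_ne_top q), one_pow, one_mul]

open Finset in
theorem measurableSet_kernel {r : ℕ} (l : Fin d → ℕ) (y : Fin r → ZMod q) :
    MeasurableSet {a : Fin d → ℕ → ZMod q | ∀ j, ∀ m < l j, ∑ i, y i * a j (m + i) = 0} := by
  simp only [Set.ofPred_forall]
  refine MeasurableSet.iInter fun j ↦ MeasurableSet.iInter fun m ↦ MeasurableSet.iInter fun _ ↦ ?_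
  have hf : Measurable fun a : Fin d → ℕ → ZMod q ↦ ∑ i, y i * a j (m + i) := by
    refine Finset.measurable_sum _ fun i _ ↦ ?_
    exact (Measurable.of_discrete (f := fun z : ZMod q ↦ y i * z)).comp
      ((measurable_pi_apply (m + (i : ℕ))).comp (measurable_pi_apply j))
  exact hf (measurableSet_singleton 0)

theorem measurable_kernelExcess (r : ℕ) (l : Fin d → ℕ) :
    Measurable fun a : Fin d → ℕ → ZMod q ↦ kernelExcess a r l := by
  have h : Measurable fun a : Fin d → ℕ → ZMod q ↦ kernelCard a r l := by
    simp only [kernelCard, Finset.card_filter]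
    exact Finset.measurable_sum _ fun y _ ↦
      Measurable.ite (measurableSet_kernel l y) measurable_const measurable_const
  exact (Measurable.of_discrete (f := fun n : ℕ ↦ n - q ^ (r - ∑ j, l j))).comp h

open Finset in
theorem lintegral_kernelExcess_le_one [IsProbabilityMeasure μ]
    (hμ : ∀ (s : Finset (Fin d × ℕ)) (v : Fin d × ℕ → ZMod q),
      μ {a | ∀ p ∈ s, a p.1 p.2 = v p} = ((q : ENNReal))⁻¹ ^ s.card)
    {r : ℕ} {l : Fin d → ℕ} (hl : ∑ j, l j ≤ r) :
    ∫⁻ a, (kernelExcess a r l : ℝ≥0∞) ∂μ ≤ 1 := by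
  have hq0 : (q : ℝ≥0∞) ≠ 0 := by exact_mod_cast (Fact.out : q.Prime).ne_zero
  have h1 : ∫⁻ a, (kernelCard a r l : ℝ≥0∞) ∂μ ≤ 1 + (q : ℝ≥0∞) ^ (r - ∑ j, l j) := by
    have e : ∀ a : Fin d → ℕ → ZMod q, (kernelCard a r l : ℝ≥0∞) = ∑ y : Fin r → ZMod q,
        Set.indicator {a | ∀ j, ∀ m < l j, ∑ i, y i * a j (m + i) = 0} (fun _ ↦ 1) a := by
      intro a
      simp only [kernelCard, card_filter, Set.indicator_apply, Set.mem_ofPred_eq]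
      push_cast
      rfl
    simp only [e]
    rw [lintegral_finsetSum _ fun y _ ↦ measurable_const.indicator (measurableSet_kernel l y)]
    simp only [lintegral_indicator_const (measurableSet_kernel l _), one_mul]
    rw [← add_sum_erase _ _ (mem_univ (0 : Fin r → ZMod q))]
    refine add_le_add prob_le_one ?_
    calc _ ≤ ∑ _y ∈ univ.erase (0 : Fin r → ZMod q), (q : ℝ≥0∞)⁻¹ ^ (∑ j, l j) :=
          sum_le_sum fun y hy ↦ measure_kernel_le hμ l (ne_of_mem_erase hy)
      _ ≤ ∑ _y : Fin r → ZMod q, (q : ℝ≥0∞)⁻¹ ^ (∑ j, l j) :=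
          sum_le_sum_of_subset (erase_subset _ _)
      _ = _ := by
          rw [sum_const, card_univ]
          simp only [Fintype.card_pi, ZMod.card, prod_const, card_univ, Fintype.card_fin,
            nsmul_eq_mul]
          push_cast
          obtain ⟨k, rfl⟩ := Nat.exists_eq_add_of_le hl
          rw [Nat.add_sub_cancel_left, pow_add, mul_comm (_ ^ _), mul_assoc, ← mul_pow,
            ENNReal.mul_inv_cancel hq0 (ENNReal.natCast_ne_top q), one_pow, mul_one]
  have e : ∀ a : Fin d → ℕ → ZMod q, (kernelCard a r l : ℝ≥0∞) =
      kernelExcess a r l + (q : ℝ≥0∞) ^ (r - ∑ j, l j) := fun a ↦ by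
    exact_mod_cast congrArg (Nat.cast : ℕ → ℝ≥0∞) (kernelExcess_spec a hl).1
  simp only [e] at h1
  rw [lintegral_add_right _ measurable_const, lintegral_const, measure_univ, mul_one] at h1
  exact (ENNReal.add_le_add_iff_right (ENNReal.pow_ne_top (ENNReal.natCast_ne_top q))).1 h1

theorem measure_kernelExcess_ne_zero_le [IsProbabilityMeasure μ]
    (hμ : ∀ (s : Finset (Fin d × ℕ)) (v : Fin d × ℕ → ZMod q),
      μ {a | ∀ p ∈ s, a p.1 p.2 = v p} = ((q : ENNReal))⁻¹ ^ s.card)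
    {r : ℕ} {l : Fin d → ℕ} (hl : ∑ j, l j ≤ r) :
    μ {a | kernelExcess a r l ≠ 0} ≤ (q : ℝ≥0∞)⁻¹ ^ (r - ∑ j, l j) := by
  have hmeas : Measurable fun a : Fin d → ℕ → ZMod q ↦ (kernelExcess a r l : ℝ≥0∞) :=
    Measurable.of_discrete.comp (measurable_kernelExcess r l)
  have h := (mul_meas_ge_le_lintegral hmeas ((q : ℝ≥0∞) ^ (r - ∑ j, l j))).trans
    (lintegral_kernelExcess_le_one hμ hl)
  rw [← ENNReal.inv_pow]
  refine (measure_mono fun a ha ↦ ?_).trans (ENNReal.le_inv_iff_mul_le.2 ((mul_comm _ _).trans_le h))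
  have := (kernelExcess_spec a hl).2.1.resolve_left ha
  show (q : ℝ≥0∞) ^ (r - ∑ j, l j) ≤ kernelExcess a r l
  exact_mod_cast this

end Probability

open Finset in
theorem card_levels_le (d r : ℕ) : #(levels (Fin d) r) ≤ (r + 1) ^ d := by
  refine (card_filter_le _ _).trans ?_
  simp

open Finset in
/-- The number of resolutions whose total level lies within `s` of the maximum `r`. -/
theorem card_levels_near_le {d : ℕ} (hd : 1 ≤ d) (r s : ℕ) :
    #{l ∈ levels (Fin d) r | r ≤ ∑ i, l i + s} ≤ (s + 1) * (r + 1) ^ (d - 1) := by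
  obtain ⟨e, rfl⟩ := Nat.exists_eq_add_of_le' hd
  have : #(range (s + 1) ×ˢ Fintype.piFinset fun _ : Fin e ↦ range (r + 1)) =
      (s + 1) * (r + 1) ^ (e + 1 - 1) := by simp
  rw [← this]
  refine card_le_card_of_injOn (fun l ↦ (r - ∑ i, l i, Fin.tail l)) ?_ ?_
  · intro l hl
    have hl' := mem_filter.1 hl
    have h1 := (mem_filter.1 hl'.1).1
    simp only [coe_product, Set.mem_prod, mem_coe, Fintype.mem_piFinset, mem_range] at h1 ⊢
    exact ⟨by have := hl'.2; omega, fun i ↦ h1 _⟩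
  · intro l hl l' hl' h
    have h1 := mem_levels.1 (mem_filter.1 hl).1
    have h1' := mem_levels.1 (mem_filter.1 hl').1
    obtain ⟨h2, h3⟩ := Prod.mk.inj h
    have h4 : ∑ i, Fin.tail l i = ∑ i, Fin.tail l' i := by rw [h3]
    simp only [Fin.tail] at h4
    have h5 : l 0 = l' 0 := by
      rw [Fin.sum_univ_succ] at h1 h1'
      rw [Fin.sum_univ_succ l, Fin.sum_univ_succ l'] at h2
      omega
    rw [← Fin.cons_self_tail l, ← Fin.cons_self_tail l', h5, h3]

/-- The number of binary digits of `r + 1`. -/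
def logSize (r : ℕ) : ℕ := Nat.log 2 (r + 1) + 1

theorem lt_two_pow_logSize (r : ℕ) : r + 1 < 2 ^ logSize r :=
  Nat.lt_pow_succ_log_self (by norm_num) _

theorem logSize_mono : Monotone logSize := fun _ _ h ↦ by
  unfold logSize
  gcongr

theorem one_le_logSize (r : ℕ) : (1 : ℝ) ≤ logSize r := by
  exact_mod_cast Nat.succ_pos _

theorem summable_inv_mul_logSize_rpow {ε : ℝ} (hε : 0 < ε) :
    Summable fun r : ℕ ↦ (((r : ℝ) + 1) * (logSize r : ℝ) ^ (1 + ε))⁻¹ := by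
  let g : ℕ → ℝ := fun n ↦ ((n : ℝ) * ((Nat.log 2 n + 1 : ℕ) : ℝ) ^ (1 + ε))⁻¹
  have hg : Summable g := by
    rw [← summable_condensed_iff_of_nonneg]
    · have h : (fun k : ℕ ↦ (2 : ℝ) ^ k * g (2 ^ k)) =
          fun k : ℕ ↦ (((k + 1 : ℕ) : ℝ) ^ (1 + ε))⁻¹ := by
        ext k
        simp only [g, Nat.log_pow (by norm_num : 1 < 2)]
        push_cast
        rw [mul_inv, mul_inv_cancel_left₀ (by positivity)]
      rw [h, summable_nat_add_iff (f := fun k : ℕ ↦ ((k : ℝ) ^ (1 + ε))⁻¹) 1]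
      exact Real.summable_nat_rpow_inv.2 (by linarith)
    · intro n; positivity
    · intro m n hm hmn
      have : (0 : ℝ) < m := Nat.cast_pos.2 hm
      simp only [g]
      gcongr
  exact_mod_cast (summable_nat_add_iff 1).2 hg

section AlmostSure

variable {q d : ℕ} [Fact q.Prime] {μ : Measure (Fin d → ℕ → ZMod q)} [IsProbabilityMeasure μ]

open Finset in
/-- Almost surely, for all large `r` every system that is short of the maximal level by a fixed
multiple of `log r` is surjective. -/
theorem ae_eventually_kernelExcess_eq_zero
    (hμ : ∀ (s : Finset (Fin d × ℕ)) (v : Fin d × ℕ → ZMod q),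
      μ {a | ∀ p ∈ s, a p.1 p.2 = v p} = ((q : ENNReal))⁻¹ ^ s.card) :
    ∀ᵐ a ∂μ, ∀ᶠ r in Filter.atTop, ∀ l ∈ levels (Fin d) r,
      ∑ i, l i + (d + 2) * logSize r < r → kernelExcess a r l = 0 := by
  let B : ℕ → Set (Fin d → ℕ → ZMod q) := fun r ↦
    ⋃ l ∈ {l ∈ levels (Fin d) r | ∑ i, l i + (d + 2) * logSize r < r}, {a | kernelExcess a r l ≠ 0}
  have hq2 : (2 : ℝ≥0∞) ≤ q := by exact_mod_cast (Fact.out : q.Prime).two_le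
  have hB : ∀ r, μ (B r) ≤ ENNReal.ofReal ((((r + 1 : ℕ) : ℝ) ^ 2)⁻¹) := by
    intro r
    have hbase : (q : ℝ≥0∞)⁻¹ ^ logSize r ≤ (((r + 1 : ℕ) : ℝ≥0∞))⁻¹ := by
      rw [← ENNReal.inv_pow, ENNReal.inv_le_inv]
      calc ((r + 1 : ℕ) : ℝ≥0∞) ≤ 2 ^ logSize r := by exact_mod_cast (lt_two_pow_logSize r).le
        _ ≤ _ := by gcongr
    have hr0 : ((r + 1 : ℕ) : ℝ≥0∞) ≠ 0 := by simp
    calc μ (B r) ≤ ∑ l ∈ levels (Fin d) r with ∑ i, l i + (d + 2) * logSize r < r,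
            μ {a | kernelExcess a r l ≠ 0} := measure_biUnion_finset_le _ _
      _ ≤ ∑ l ∈ levels (Fin d) r with ∑ i, l i + (d + 2) * logSize r < r,
            (((r + 1 : ℕ) : ℝ≥0∞))⁻¹ ^ (d + 2) := by
          refine sum_le_sum fun l hl ↦ ?_
          obtain ⟨h1, h2⟩ := mem_filter.1 hl
          calc _ ≤ (q : ℝ≥0∞)⁻¹ ^ (r - ∑ j, l j) :=
                measure_kernelExcess_ne_zero_le hμ (mem_levels.1 h1)
            _ ≤ (q : ℝ≥0∞)⁻¹ ^ (logSize r * (d + 2)) := by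
                refine pow_le_pow_right_of_le_one' (ENNReal.inv_le_one.2 ?_) ?_
                · exact le_trans (by norm_num) hq2
                · rw [mul_comm]; omega
            _ ≤ _ := by rw [pow_mul]; gcongr
      _ ≤ ((r + 1 : ℕ) : ℝ≥0∞) ^ d * (((r + 1 : ℕ) : ℝ≥0∞))⁻¹ ^ (d + 2) := by
          rw [sum_const, nsmul_eq_mul]
          gcongr
          exact_mod_cast (card_filter_le _ _).trans (card_levels_le d r)
      _ = _ := by
          rw [pow_add, ← mul_assoc, ← mul_pow, ENNReal.mul_inv_cancel hr0
            (ENNReal.natCast_ne_top _), one_pow, one_mul, ENNReal.ofReal_inv_of_pos (by positivity),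
            ENNReal.ofReal_pow (by positivity), ENNReal.ofReal_natCast, ENNReal.inv_pow]
  have hsum : ∑' r, μ (B r) ≠ ∞ := by
    refine ne_top_of_le_ne_top ?_ (ENNReal.tsum_le_tsum hB)
    have : Summable fun r : ℕ ↦ (((r + 1 : ℕ) : ℝ) ^ 2)⁻¹ :=
      (summable_nat_add_iff (f := fun r : ℕ ↦ ((r : ℝ) ^ 2)⁻¹) 1).2
        (Real.summable_nat_pow_inv.2 (by norm_num))
    exact this.tsum_ofReal_ne_top
  filter_upwards [ae_eventually_notMem hsum] with a ha
  filter_upwards [ha] with r hr l hl hlr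
  by_contra h
  exact hr (Set.mem_biUnion (mem_coe.2 (mem_filter.2 ⟨hl, hlr⟩)) h)

open Finset in
/-- Almost surely, the excesses near the maximal level have the expected size on average. -/
theorem ae_exists_sum_near_le (hd : 1 ≤ d)
    (hμ : ∀ (s : Finset (Fin d × ℕ)) (v : Fin d × ℕ → ZMod q),
      μ {a | ∀ p ∈ s, a p.1 p.2 = v p} = ((q : ENNReal))⁻¹ ^ s.card) {ε : ℝ} (hε : 0 < ε) :
    ∀ᵐ a ∂μ, ∃ K : ℝ, 0 ≤ K ∧ ∀ M : ℕ,
      ∑ r ∈ range M, ∑ l ∈ levels (Fin d) r with r ≤ ∑ i, l i + (d + 2) * logSize r,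
        (kernelExcess a r l : ℝ) ≤ K * (((M : ℝ) + 1) ^ d * (logSize M : ℝ) ^ (2 + ε)) := by
  let w : ℕ → ℝ := fun r ↦ ((r : ℝ) + 1) ^ d * (logSize r : ℝ) ^ (2 + ε)
  have hL : ∀ r, (0 : ℝ) < logSize r := fun r ↦ one_pos.trans_le (one_le_logSize r)
  have hw : ∀ r, 0 < w r := fun r ↦ by have := hL r; positivity
  have hwmono : Monotone w := fun r r' h ↦ by
    have h1 : (logSize r : ℝ) ≤ logSize r' := Nat.cast_le.2 (logSize_mono h)
    have := hL r
    simp only [w]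
    gcongr
  let Y : ℕ → (Fin d → ℕ → ZMod q) → ℝ≥0∞ := fun r a ↦
    ∑ l ∈ levels (Fin d) r with r ≤ ∑ i, l i + (d + 2) * logSize r, (kernelExcess a r l : ℝ≥0∞)
  have hexm : ∀ r l, Measurable fun a : Fin d → ℕ → ZMod q ↦ (kernelExcess a r l : ℝ≥0∞) :=
    fun r l ↦ Measurable.of_discrete.comp (measurable_kernelExcess r l)
  have hYm : ∀ r, Measurable (Y r) := fun r ↦ Finset.measurable_sum _ fun l _ ↦ hexm r l
  have hY : ∀ r, ∫⁻ a, Y r a ∂μ ≤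
      ENNReal.ofReal ((d + 3) * logSize r * ((r : ℝ) + 1) ^ (d - 1)) := by
    intro r
    simp only [Y]
    rw [lintegral_finsetSum _ fun l _ ↦ hexm r l]
    calc _ ≤ ∑ l ∈ levels (Fin d) r with r ≤ ∑ i, l i + (d + 2) * logSize r, (1 : ℝ≥0∞) :=
          sum_le_sum fun l hl ↦
            lintegral_kernelExcess_le_one hμ (mem_levels.1 (mem_filter.1 hl).1)
      _ ≤ (((d + 3) * logSize r * (r + 1) ^ (d - 1) : ℕ) : ℝ≥0∞) := by
          rw [sum_const, nsmul_eq_mul, mul_one, Nat.cast_le]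
          refine (card_levels_near_le hd r _).trans (Nat.mul_le_mul_right _ ?_)
          have : 1 ≤ logSize r := Nat.succ_pos _
          nlinarith
      _ = _ := by
          rw [← ENNReal.ofReal_natCast]
          push_cast
          rfl
  have hfin : ∫⁻ a, ∑' r, ENNReal.ofReal (w r)⁻¹ * Y r a ∂μ ≠ ∞ := by
    rw [lintegral_tsum fun r ↦ ((hYm r).const_mul _).aemeasurable]
    refine ne_top_of_le_ne_top
      (((summable_inv_mul_logSize_rpow hε).mul_left ((d : ℝ) + 3)).tsum_ofReal_ne_top)
      (ENNReal.tsum_le_tsum fun r ↦ ?_)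
    rw [lintegral_const_mul _ (hYm r)]
    refine (mul_le_mul_right (hY r) _).trans ?_
    rw [← ENNReal.ofReal_mul (inv_nonneg.2 (hw r).le)]
    refine ENNReal.ofReal_le_ofReal (le_of_eq ?_)
    obtain ⟨e, rfl⟩ := Nat.exists_eq_add_of_le' hd
    have h1 : (logSize r : ℝ) ^ (2 + ε) = logSize r * (logSize r : ℝ) ^ (1 + ε) := by
      rw [← Real.rpow_one_add' (hL r).le (by positivity)]
      ring_nf
    have h2 := hL r
    simp only [w, h1, Nat.add_sub_cancel]
    field_simp
    ring
  filter_upwards [ae_lt_top (Measurable.tsum fun r ↦ (hYm r).const_mul _) hfin] with a ha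
  refine ⟨_, ENNReal.toReal_nonneg (a := ∑' r, ENNReal.ofReal (w r)⁻¹ * Y r a), fun M ↦ ?_⟩
  have hYtop : ∀ r, Y r a ≠ ∞ := fun r ↦ ENNReal.sum_ne_top.2 fun _ _ ↦ ENNReal.natCast_ne_top _
  have hpart : ∑ r ∈ range M, (w r)⁻¹ * (Y r a).toReal ≤
      (∑' r, ENNReal.ofReal (w r)⁻¹ * Y r a).toReal := by
    have h := ENNReal.toReal_mono ha.ne
      (ENNReal.sum_le_tsum (f := fun r ↦ ENNReal.ofReal (w r)⁻¹ * Y r a) (range M))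
    rw [ENNReal.toReal_sum fun r _ ↦ ENNReal.mul_ne_top ENNReal.ofReal_ne_top (hYtop r)] at h
    simpa only [ENNReal.toReal_mul, ENNReal.toReal_ofReal (inv_nonneg.2 (hw _).le)] using h
  rw [← div_le_iff₀ (hw M), div_eq_inv_mul, mul_sum]
  refine le_trans (sum_le_sum fun r hr ↦ ?_) hpart
  have hYr : (Y r a).toReal = ∑ l ∈ levels (Fin d) r with r ≤ ∑ i, l i + (d + 2) * logSize r,
      (kernelExcess a r l : ℝ) := by
    simp only [Y]
    rw [ENNReal.toReal_sum fun _ _ ↦ ENNReal.natCast_ne_top _]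
    simp
  rw [hYr]
  refine mul_le_mul_of_nonneg_right ?_ (sum_nonneg fun _ _ ↦ Nat.cast_nonneg _)
  exact inv_anti₀ (hw r) (hwmono (mem_range.1 hr).le)

open Finset in
/-- Almost surely, the sum of the block bounds has the order claimed for the discrepancy. -/
theorem ae_exists_sum_blockBound_le (hd : 1 ≤ d)
    (hμ : ∀ (s : Finset (Fin d × ℕ)) (v : Fin d × ℕ → ZMod q),
      μ {a | ∀ p ∈ s, a p.1 p.2 = v p} = ((q : ENNReal))⁻¹ ^ s.card) {ε : ℝ} (hε : 0 < ε) :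
    ∀ᵐ a ∂μ, ∃ K : ℝ, 0 ≤ K ∧ ∀ M : ℕ, ∑ r ∈ range M, blockBound a r ≤
      K * (((M : ℝ) + 1) ^ d * (logSize M : ℝ) ^ (2 + ε)) := by
  filter_upwards [ae_eventually_kernelExcess_eq_zero hμ, ae_exists_sum_near_le hd hμ hε]
    with a h0 ⟨K, hK0, hK⟩
  obtain ⟨R, hR⟩ := Filter.eventually_atTop.1 h0
  set Z : ℝ := ∑ r ∈ range R, ∑ l ∈ levels (Fin d) r, (kernelExcess a r l : ℝ) with hZ
  have hZ0 : 0 ≤ Z := sum_nonneg fun _ _ ↦ sum_nonneg fun _ _ ↦ Nat.cast_nonneg _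
  refine ⟨q ^ d * (K + Z + 1), by positivity, fun M ↦ ?_⟩
  set W : ℝ := ((M : ℝ) + 1) ^ d * (logSize M : ℝ) ^ (2 + ε) with hW
  have hLW : (1 : ℝ) ≤ (logSize M : ℝ) ^ (2 + ε) :=
    Real.one_le_rpow (one_le_logSize M) (by positivity)
  have hMW : ((M : ℝ) + 1) ^ d ≤ W := le_mul_of_one_le_right (by positivity) hLW
  have hW1 : 1 ≤ W := (one_le_pow₀ (by linarith [Nat.cast_nonneg (α := ℝ) M])).trans hMW
  have hcount : ∑ r ∈ range M, ∑ l ∈ levels (Fin d) r,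
      (if ∑ i, l i = r then (1 : ℝ) else 0) ≤ W := by
    refine le_trans (sum_le_card_nsmul _ _ (((M : ℝ) + 1) ^ (d - 1)) fun r hr ↦ ?_) ?_
    · rw [← sum_filter, sum_const, nsmul_eq_mul, mul_one]
      have h1 := card_levels_near_le hd r 0
      have h2 : #{l ∈ levels (Fin d) r | ∑ i, l i = r} ≤ #{l ∈ levels (Fin d) r |
          r ≤ ∑ i, l i + 0} := card_le_card (monotone_filter_right _ fun l _ h ↦ by simpa using h.ge)
      have h3 : (r + 1) ^ (d - 1) ≤ (M + 1) ^ (d - 1) :=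
        Nat.pow_le_pow_left (by have := mem_range.1 hr; omega) _
      rw [zero_add, one_mul] at h1
      exact_mod_cast (h2.trans h1).trans h3
    · rw [card_range, nsmul_eq_mul]
      refine le_trans ?_ hMW
      obtain ⟨e, rfl⟩ := Nat.exists_eq_add_of_le' hd
      rw [Nat.add_sub_cancel, pow_succ']
      gcongr
      linarith
  have hexcess : ∑ r ∈ range M, ∑ l ∈ levels (Fin d) r, (kernelExcess a r l : ℝ) ≤ K * W + Z := by
    let f : ℕ → ℝ := fun r ↦ ∑ l ∈ levels (Fin d) r with
      ¬ r ≤ ∑ i, l i + (d + 2) * logSize r, (kernelExcess a r l : ℝ)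
    have hf0 : ∀ r, 0 ≤ f r := fun r ↦ sum_nonneg fun _ _ ↦ Nat.cast_nonneg _
    have hfR : ∀ r, R ≤ r → f r = 0 := fun r hr ↦ sum_eq_zero fun l hl ↦ by
      obtain ⟨h1, h2⟩ := mem_filter.1 hl
      rw [hR r hr l h1 (not_le.1 h2), Nat.cast_zero]
    have hfZ : ∑ r ∈ range M, f r ≤ Z := by
      calc ∑ r ∈ range M, f r ≤ ∑ r ∈ range (M + R), f r :=
            sum_le_sum_of_subset_of_nonneg (range_subset_range.2 (by omega)) fun _ _ _ ↦ hf0 _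
        _ = ∑ r ∈ range R, f r :=
            (sum_subset (range_subset_range.2 (by omega)) fun r _ hr ↦
              hfR r (by simpa using hr)).symm
        _ ≤ Z := sum_le_sum fun r _ ↦
            sum_le_sum_of_subset_of_nonneg (filter_subset _ _) fun _ _ _ ↦ Nat.cast_nonneg _
    have hsplit : ∀ r, ∑ l ∈ levels (Fin d) r, (kernelExcess a r l : ℝ) =
        (∑ l ∈ levels (Fin d) r with r ≤ ∑ i, l i + (d + 2) * logSize r,
          (kernelExcess a r l : ℝ)) + f r := fun r ↦ (sum_filter_add_sum_filter_not _ _ _).symm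
    rw [sum_congr rfl fun r _ ↦ hsplit r, sum_add_distrib]
    exact add_le_add (hK M) hfZ
  simp only [blockBound, Nat.cast_sum, Nat.cast_add, Nat.cast_ite, Nat.cast_one, Nat.cast_zero,
    sum_add_distrib, ← mul_sum]
  rw [mul_assoc]
  refine mul_le_mul_of_nonneg_left ?_ (by positivity)
  nlinarith

end AlmostSure

/-- Comparison of `logSize (log_q N + 1)` with `log log N`. -/
theorem exists_logSize_le {q : ℕ} (hq : 2 ≤ q) : ∃ c : ℝ, 0 < c ∧ ∀ N : ℕ, 3 ≤ N →
    ((Nat.log q N + 1 : ℕ) : ℝ) + 1 ≤ 4 * Real.log N ∧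
      0 < Real.log (Real.log N) ∧
      (logSize (Nat.log q N + 1) : ℝ) ≤ c * Real.log (Real.log N) := by
  have h3 : 1 < Real.log 3 := by
    rw [Real.lt_log_iff_exp_lt (by norm_num)]
    exact Real.exp_one_lt_d9.trans (by norm_num)
  set δ := Real.log (Real.log 3) with hδ
  have hδ0 : 0 < δ := Real.log_pos h3
  refine ⟨2 + 4 / δ, by positivity, fun N hN ↦ ?_⟩
  have hlog2 : 0.69 < Real.log 2 := by linarith [Real.log_two_gt_d9]
  have hN3 : (3 : ℝ) ≤ N := by exact_mod_cast hN
  have hlogN : Real.log 3 ≤ Real.log N := Real.log_le_log (by norm_num) hN3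
  have hll : δ ≤ Real.log (Real.log N) := Real.log_le_log (by linarith) hlogN
  have hnat : ∀ n : ℕ, 0 < n → (Nat.log 2 n : ℝ) * Real.log 2 ≤ Real.log n := by
    intro n hn
    rw [← Real.log_pow]
    refine Real.log_le_log (by positivity) ?_
    exact_mod_cast Nat.pow_log_le_self 2 hn.ne'
  have h1 : (Nat.log q N : ℝ) ≤ Nat.log 2 N := Nat.cast_le.2 (Nat.log_anti_left (by norm_num) hq)
  have h2 := hnat N (by omega)
  have hM : ((Nat.log q N + 1 : ℕ) : ℝ) + 1 ≤ 4 * Real.log N := by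
    push_cast
    nlinarith
  refine ⟨hM, hδ0.trans_le hll, ?_⟩
  have h4 := hnat (Nat.log q N + 1 + 1) (by omega)
  have h5 : Real.log ((Nat.log q N + 1 + 1 : ℕ) : ℝ) ≤
      2 * Real.log 2 + Real.log (Real.log N) := by
    have e : 2 * Real.log 2 + Real.log (Real.log N) = Real.log (4 * Real.log N) := by
      rw [Real.log_mul (by norm_num) (by linarith), show (4 : ℝ) = 2 ^ 2 by norm_num, Real.log_pow]
      norm_num
    rw [e]
    exact Real.log_le_log (by positivity) (by exact_mod_cast hM)
  have h6 : 4 ≤ 4 / δ * Real.log (Real.log N) := by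
    rw [div_mul_eq_mul_div, le_div_iff₀ hδ0]
    linarith
  have h7 : ((Nat.log 2 (Nat.log q N + 1 + 1) : ℕ) : ℝ) ≤ 2 + 2 * Real.log (Real.log N) := by
    have : 0 < Real.log (Real.log N) := hδ0.trans_le hll
    nlinarith
  simp only [logSize]
  push_cast
  linarith

theorem stmt3 (d : ℕ) (hd : 1 ≤ d) (q : ℕ) (hq : q.Prime) (ε : ℝ) (hε : 0 < ε)
    (μ : Measure (Fin d → ℕ → ZMod q)) [IsProbabilityMeasure μ]
    (hμ : ∀ (s : Finset (Fin d × ℕ)) (v : Fin d × ℕ → ZMod q),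
      μ {a | ∀ p ∈ s, a p.1 p.2 = v p} = ((q : ENNReal))⁻¹ ^ s.card) :
    ∀ᵐ a ∂μ, ∃ C > 0, ∀ N : ℕ, 3 ≤ N →
      starDisc (digitalKronecker d a) N
        ≤ C * Real.log N ^ d * Real.log (Real.log N) ^ ((2 : ℝ) + ε) / N := by
  have : Fact q.Prime := ⟨hq⟩
  obtain ⟨c, hc, hcN⟩ := exists_logSize_le hq.two_le
  filter_upwards [ae_exists_sum_blockBound_le hd hμ hε] with a ⟨K, hK0, hK⟩
  refine ⟨q * K * 4 ^ d * c ^ (2 + ε) + 1, by positivity, fun N hN ↦ ?_⟩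
  obtain ⟨hM, hll, hsize⟩ := hcN N hN
  have hlog : 0 ≤ Real.log N := Real.log_natCast_nonneg N
  refine (starDisc_digitalKronecker_le hq.two_le a (by omega)
    (Nat.lt_pow_succ_log_self hq.one_lt N)).trans ?_
  have hpow : (((Nat.log q N + 1 : ℕ) : ℝ) + 1) ^ d ≤ 4 ^ d * Real.log N ^ d := by
    rw [← mul_pow]
    gcongr
  have hrpow : (logSize (Nat.log q N + 1) : ℝ) ^ (2 + ε) ≤
      c ^ (2 + ε) * Real.log (Real.log N) ^ (2 + ε) := by
    rw [← Real.mul_rpow hc.le hll.le]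
    gcongr
  refine div_le_div_of_nonneg_right ?_ (Nat.cast_nonneg N)
  calc (q : ℝ) * ∑ r ∈ Finset.range (Nat.log q N + 1), blockBound a r
      ≤ q * (K * ((4 ^ d * Real.log N ^ d) * (c ^ (2 + ε) * Real.log (Real.log N) ^ (2 + ε)))) := by
        refine mul_le_mul_of_nonneg_left ((hK _).trans ?_) (Nat.cast_nonneg _)
        gcongr
    _ = q * K * 4 ^ d * c ^ (2 + ε) * Real.log N ^ d * Real.log (Real.log N) ^ (2 + ε) := by ring
    _ ≤ _ := by
        gcongr
        linarith
end

section
/- Let d ≥ 1 and let q be a prime. There exists a constant c(q,d) > 0 such that for μ_d-almost all d-tuples (C_1,…,C_d) of ℕ×ℕ matrices over Z_q, where μ_d is the product probability measure under which all matrix entries are independent and uniformly distributed on Z_q, the discrepancy of the digital sequence S(C_1,…,C_d) satisfies D_N(S(C_1,…,C_d)) ≥ c(q,d) · (log N)^d (log log N) / N for infinitely many N ∈ ℕ. -/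
open MeasureTheory Real

/-- The discrepancy of the first `N` points of a sequence `z` in `[0,1)^ι`. -/
noncomputable def disc {ι : Type*} [Fintype ι] (z : ℕ → ι → ℝ) (N : ℕ) : ℝ :=
  sSup { r : ℝ | ∃ u v : ι → ℝ,
    (∀ i, 0 ≤ u i ∧ u i ≤ v i ∧ v i ≤ 1) ∧
    r = |(Nat.card {n : ℕ // n < N ∧ ∀ i, u i ≤ z n i ∧ z n i < v i} : ℝ) / N
          - ∏ i, (v i - u i)| }

/-- The digital sequence over `ZMod q` generated by the `ℕ × ℕ` matrices `C j`:
the `j`-th coordinate of the `n`-th point is `∑_{k≥0} y_{j,k} / q^(k+1)`, where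
`y_{j,k} ∈ {0,…,q-1}` is the value of the `k`-th entry of `C j` applied to the
vector of base-`q` digits of `n`. -/
noncomputable def digitalSeq {q : ℕ} (d : ℕ) (C : Fin d → ℕ → ℕ → ZMod q)
    (n : ℕ) : Fin d → ℝ :=
  fun j => ∑' k : ℕ,
    ((∑ i ∈ Finset.range (Nat.digits q n).length,
        C j k i * ((Nat.digits q n).getD i 0 : ZMod q)).val : ℝ) / (q : ℝ) ^ (k + 1)

open ProbabilityTheory

/-- A divergence Borel–Cantelli principle for pairwise independent events. -/
theorem ae_exists_mem_of_pairwise_independent {Ω ι : Type*} [MeasurableSpace Ω] (μ : Measure Ω)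
    [IsProbabilityMeasure μ] (E : ι → Set Ω) (hE : ∀ i, MeasurableSet (E i)) (I : Set ι)
    (hind : ∀ i j, i ≠ j → μ (E i ∩ E j) = μ (E i) * μ (E j))
    (hdiv : ∀ S : ℝ, ∃ F : Finset ι, (∀ i ∈ F, i ∈ I) ∧ S ≤ ∑ i ∈ F, μ.real (E i)) :
    ∀ᵐ ω ∂μ, ∃ i ∈ I, ω ∈ E i := by
  have key : ∀ S : ℝ, 0 < S → μ {ω | ¬ ∃ i ∈ I, ω ∈ E i} ≤ ENNReal.ofReal S⁻¹ := by
    intro S hS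
    obtain ⟨F, hFI, hF⟩ := hdiv S
    set s : ℝ := ∑ i ∈ F, μ.real (E i) with hs
    have hs0 : 0 < s := hS.trans_le hF
    let X : ι → Ω → ℝ := fun i => (E i).indicator 1
    have hL : ∀ i, MemLp (X i) 2 μ := fun i =>
      memLp_indicator_const 2 (hE i) 1 (Or.inr (measure_ne_top _ _))
    have hint : ∀ i, ∫ ω, X i ω ∂μ = μ.real (E i) := fun i => integral_indicator_one (hE i)
    have hmean : ∫ ω, (∑ i ∈ F, X i) ω ∂μ = s := by
      simp only [Finset.sum_apply]
      rw [integral_finsetSum _ fun i _ => (hL i).integrable (by norm_num)]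
      exact Finset.sum_congr rfl fun i _ => hint i
    have hvar : Var[∑ i ∈ F, X i; μ] ≤ s := by
      rw [IndepFun.variance_sum (fun i _ => hL i)]
      · refine Finset.sum_le_sum fun i _ => ?_
        refine (variance_le_expectation_sq (hL i).1).trans (le_of_eq ?_)
        rw [← hint i]
        congr 1
        ext ω
        by_cases h : ω ∈ E i <;> simp [X, h]
      · intro i _ j _ hij
        have := (indepSet_iff_measure_inter_eq_mul (hE i) (hE j) μ).2 (hind i j hij)
        have hmeas : ∀ k, Measurable[MeasurableSpace.generateFrom {E k}] (X k) := fun k =>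
          (@measurable_one _ _ _ (MeasurableSpace.generateFrom {E k}) _).indicator
            (MeasurableSpace.measurableSet_generateFrom rfl)
        exact (IndepFun_iff_Indep _ _ _).2 <| indep_of_indep_of_le_left
          (indep_of_indep_of_le_right this (hmeas j).comap_le) (hmeas i).comap_le
    have hche := meas_ge_le_variance_div_sq (memLp_finsetSum' F fun i _ => hL i) hs0
    rw [hmean] at hche
    refine (measure_mono ?_).trans (hche.trans (ENNReal.ofReal_le_ofReal ?_))
    · intro ω hω
      have h0 : (∑ i ∈ F, X i) ω = 0 := by
        rw [Finset.sum_apply]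
        refine Finset.sum_eq_zero fun i hi => ?_
        exact Set.indicator_of_notMem (fun h => hω ⟨i, hFI i hi, h⟩) _
      simp only [Set.mem_ofPred_eq, h0, zero_sub, abs_neg]
      exact le_abs_self s
    · calc _ ≤ s / s ^ 2 := by gcongr
        _ = s⁻¹ := by field_simp
        _ ≤ S⁻¹ := by gcongr
  rw [ae_iff]
  refine le_antisymm (ENNReal.le_of_forall_pos_le_add fun ε hε _ => ?_) (zero_le)
  have := key (ε : ℝ)⁻¹ (by positivity)
  rw [inv_inv, ENNReal.ofReal_coe_nnreal] at this
  simpa using this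

/-- A surjective homomorphism depending on finitely many of the uniform independent entries
vanishes with probability the inverse of the size of its codomain. -/
theorem measure_addMonoidHom_eq_zero {d q : ℕ} (hq : q.Prime)
    (μ : Measure (Fin d → ℕ → ℕ → ZMod q))
    (hμ : ∀ (s : Finset (Fin d × ℕ × ℕ)) (v : Fin d × ℕ × ℕ → ZMod q),
      μ {C | ∀ p ∈ s, C p.1 p.2.1 p.2.2 = v p} = ((q : ENNReal))⁻¹ ^ s.card)
    {W : Type*} [AddCommGroup W] (Φ : (Fin d → ℕ → ℕ → ZMod q) →+ W)
    (hΦ : Function.Surjective Φ) (s : Finset (Fin d × ℕ × ℕ))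
    (hs : ∀ C, (∀ p ∈ s, C p.1 p.2.1 p.2.2 = 0) → Φ C = 0) :
    MeasurableSet {C | Φ C = 0} ∧ μ {C | Φ C = 0} = (Nat.card W : ENNReal)⁻¹ := by
  classical
  have : Fact q.Prime := ⟨hq⟩
  let ext : (s → ZMod q) →+ (Fin d → ℕ → ℕ → ZMod q) :=
    { toFun := fun v j r i => if h : (j, r, i) ∈ s then v ⟨_, h⟩ else 0
      map_zero' := by ext; simp
      map_add' := by
        intro v w
        ext j r i
        by_cases h : (j, r, i) ∈ s <;> simp [h] }
  let ρ : (Fin d → ℕ → ℕ → ZMod q) → (s → ZMod q) := fun C p => C p.1.1 p.1.2.1 p.1.2.2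
  have hext : ∀ C, Φ (ext (ρ C)) = Φ C := by
    intro C
    rw [← sub_eq_zero, ← map_sub]
    refine hs _ fun p hp => ?_
    simp [ext, ρ, hp]
  let Ψ : (s → ZMod q) →+ W := Φ.comp ext
  have hΨ : Function.Surjective Ψ := fun w => by
    obtain ⟨C, rfl⟩ := hΦ w
    exact ⟨ρ C, hext C⟩
  have hρ : ∀ v : s → ZMod q, MeasurableSet {C | ρ C = v} ∧
      μ {C | ρ C = v} = ((q : ENNReal))⁻¹ ^ s.card := by
    intro v
    have : {C | ρ C = v} = {C | ∀ p ∈ s, C p.1 p.2.1 p.2.2 =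
        (fun p => if h : p ∈ s then v ⟨p, h⟩ else 0) p} := by
      ext C
      simp only [Set.mem_ofPred_eq, funext_iff, ρ, Subtype.forall]
      refine forall₂_congr fun p hp => ?_
      simp [hp]
    refine ⟨?_, this ▸ hμ s _⟩
    rw [this]
    have : {C : Fin d → ℕ → ℕ → ZMod q | ∀ p ∈ s, C p.1 p.2.1 p.2.2 =
        (fun p => if h : p ∈ s then v ⟨p, h⟩ else 0) p} =
        ⋂ p ∈ s, (fun C : Fin d → ℕ → ℕ → ZMod q => C p.1 p.2.1 p.2.2) ⁻¹'
          {(fun p => if h : p ∈ s then v ⟨p, h⟩ else 0) p} := by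
      ext C; simp
    rw [this]
    refine Finset.measurableSet_biInter _ fun p _ => ?_
    refine MeasurableSpace.measurableSet_top.preimage ?_
    exact (measurable_pi_apply p.2.2).comp
      ((measurable_pi_apply p.2.1).comp (measurable_pi_apply p.1))
  let T : Finset (s → ZMod q) := Finset.univ.filter fun v => Ψ v = 0
  have hT : {C | Φ C = 0} = ⋃ v ∈ T, {C | ρ C = v} := by
    ext C
    simp [T, Ψ, hext]
  have hcard : T.card * Nat.card W = q ^ s.card := by
    have h1 := AddSubgroup.card_mul_index Ψ.ker
    rw [AddSubgroup.index_ker, AddMonoidHom.range_eq_top.2 hΨ, Nat.card_congr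
      (AddSubgroup.topEquiv (G := W)).toEquiv] at h1
    have h2 : Nat.card Ψ.ker = T.card := by
      refine Nat.subtype_card T fun v => ?_
      simp [T, AddMonoidHom.mem_ker]
    rw [← h2, h1]
    simp
  have hW : (Nat.card W : ENNReal) ≠ 0 := by
    have : Nat.card W ≠ 0 := fun h => by
      rw [h, mul_zero] at hcard
      exact (pow_pos hq.pos _).ne hcard
    exact_mod_cast this
  refine ⟨?_, ?_⟩
  · rw [hT]
    exact Finset.measurableSet_biUnion _ fun v _ => (hρ v).1
  · rw [hT, measure_biUnion_finset _ fun v _ => (hρ v).1]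
    · rw [Finset.sum_congr rfl fun v _ => (hρ v).2, Finset.sum_const, nsmul_eq_mul]
      refine ENNReal.eq_inv_of_mul_eq_one_left ?_
      rw [mul_right_comm, ← Nat.cast_mul, hcard, Nat.cast_pow, ← mul_pow,
        ENNReal.mul_inv_cancel (by exact_mod_cast hq.ne_zero) (ENNReal.natCast_ne_top q), one_pow]
    · intro v _ w _ hvw
      refine Set.disjoint_left.2 fun C hv hw => hvw ?_
      exact hv.symm.trans hw

/-- A number below `x ≤ q ^ -(i + 1)` has vanishing digit of index `i`, whichever expansion is
chosen. -/
theorem ofDigits_digit_eq_zero {q : ℕ} (hq : 2 ≤ q) (a : ℕ → Fin q) {i : ℕ} {x : ℝ}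
    (hx : x * (q : ℝ) ^ (i + 1) ≤ 1) (h : Real.ofDigits a < x) :
    (a i : ℕ) = 0 := by
  by_contra h0
  have hq0 : (0 : ℝ) < (q : ℝ) ^ (i + 1) := by positivity
  have h1 : (1 : ℝ) ≤ (a i : ℕ) := by exact_mod_cast Nat.one_le_iff_ne_zero.2 h0
  have h2 : Real.ofDigitsTerm a i ≤ Real.ofDigits a :=
    Real.summable_ofDigitsTerm.le_tsum i fun _ _ => Real.ofDigitsTerm_nonneg
  have h3 : ((a i : ℕ) : ℝ) ≤ Real.ofDigits a * (q : ℝ) ^ (i + 1) := by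
    rw [Real.ofDigitsTerm] at h2
    rw [← div_le_iff₀ hq0, div_eq_mul_inv]
    exact h2
  nlinarith

/-- The digits of a number in `[3/2 * q ^ -(n + 1), 2 * q ^ -(n + 1))`; staying away from
`q ^ -(n + 1)` excludes expansions ending in the digit `q - 1`. -/
theorem ofDigits_digit_eq_one {q : ℕ} (hq : 2 ≤ q) (a : ℕ → Fin q) {n : ℕ}
    (h1 : 3 / 2 * ((q : ℝ) ^ (n + 1))⁻¹ ≤ Real.ofDigits a)
    (h2 : Real.ofDigits a < 2 * ((q : ℝ) ^ (n + 1))⁻¹) :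
    (∀ i < n, (a i : ℕ) = 0) ∧ (a n : ℕ) = 1 := by
  have hq' : (2 : ℝ) ≤ q := by exact_mod_cast hq
  have hlt : ∀ i < n, (a i : ℕ) = 0 := by
    intro i hi
    refine ofDigits_digit_eq_zero hq a ?_ h2
    have : (q : ℝ) * (q : ℝ) ^ (i + 1) ≤ (q : ℝ) ^ (n + 1) := by
      rw [← pow_succ']
      exact pow_le_pow_right₀ (by linarith) (by omega)
    have h0 : (0 : ℝ) < (q : ℝ) ^ (i + 1) := by positivity
    rw [mul_right_comm, ← div_eq_mul_inv, div_le_one (by positivity)]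
    nlinarith
  refine ⟨hlt, ?_⟩
  have hz : ∑ i ∈ Finset.range n, Real.ofDigitsTerm a i = 0 :=
    Finset.sum_eq_zero fun i hi => by
      simp [Real.ofDigitsTerm, hlt i (Finset.mem_range.1 hi)]
  have hsum := Real.ofDigits_eq_sum_add_ofDigits a (n + 1)
  rw [Finset.sum_range_succ, hz, zero_add, Real.ofDigitsTerm] at hsum
  set τ := Real.ofDigits fun i => a (i + (n + 1))
  have hτ0 : 0 ≤ τ := Real.ofDigits_nonneg _
  have hτ1 : τ ≤ 1 := Real.ofDigits_le_one _
  have hp : (0 : ℝ) < ((q : ℝ) ^ (n + 1))⁻¹ := by positivity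
  set p := ((q : ℝ) ^ (n + 1))⁻¹
  have e : Real.ofDigits a = p * ((a n : ℕ) + τ) := by rw [hsum]; ring
  rw [e, mul_comm] at h1 h2
  rw [mul_comm p] at h1
  have h3 : (3 / 2 : ℝ) ≤ (a n : ℕ) + τ := by nlinarith
  have h4 : ((a n : ℕ) : ℝ) + τ < 2 := by nlinarith
  have h5 : (0 : ℝ) < (a n : ℕ) := by linarith
  have h6 : ((a n : ℕ) : ℝ) < 2 := by linarith
  have h7 : 0 < (a n : ℕ) := by exact_mod_cast h5
  have h8 : (a n : ℕ) < 2 := by exact_mod_cast h6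
  omega

/-- Tuples of monic polynomials over `ZMod q`: the degrees together with the lower
coefficients. -/
abbrev MonicTuple (d q : ℕ) : Type := Σ n : Fin d → ℕ, ∀ j, Fin (n j) → ZMod q

namespace MonicTuple

variable {d q : ℕ}

/-- The coefficient of degree `r` of the `j`-th polynomial. -/
def coeff (k : MonicTuple d q) (j : Fin d) (r : ℕ) : ZMod q :=
  if h : r < k.1 j then k.2 j ⟨r, h⟩ else if r = k.1 j then 1 else 0

theorem coeff_degree (k : MonicTuple d q) (j : Fin d) : k.coeff j (k.1 j) = 1 := by
  simp [coeff]

theorem coeff_of_degree_lt (k : MonicTuple d q) {j : Fin d} {r : ℕ} (h : k.1 j < r) :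
    k.coeff j r = 0 := by
  simp [coeff, h.not_gt, h.ne']

theorem coeff_of_lt_degree (k : MonicTuple d q) {j : Fin d} {r : ℕ} (h : r < k.1 j) :
    k.coeff j r = k.2 j ⟨r, h⟩ := by
  simp [coeff, h]

theorem coeff_injective (hq : 1 < q) :
    Function.Injective (coeff : MonicTuple d q → Fin d → ℕ → ZMod q) := by
  have : Fact (1 < q) := ⟨hq⟩
  have hle : ∀ k k' : MonicTuple d q, k.coeff = k'.coeff → ∀ j, k.1 j ≤ k'.1 j := by
    intro k k' h j
    by_contra! hlt
    have h1 := congrFun (congrFun h j) (k.1 j)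
    rw [coeff_degree, coeff_of_degree_lt k' hlt] at h1
    exact one_ne_zero h1
  intro k k' h
  have hdeg : k.1 = k'.1 := funext fun j => (hle k k' h j).antisymm (hle k' k h.symm j)
  obtain ⟨n, c⟩ := k
  obtain ⟨n', c'⟩ := k'
  obtain rfl : n = n' := hdeg
  congr 1
  ext j r
  have h1 := congrFun (congrFun h j) r
  rwa [coeff_of_lt_degree _ r.2, coeff_of_lt_degree _ r.2] at h1

/-- Two distinct monic tuples have a nonvanishing `2 × 2` minor. -/
theorem exists_minor_ne_zero (hq : 1 < q) (j₀ : Fin d) {k k' : MonicTuple d q} (hk : k ≠ k') :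
    ∃ p p' : Fin d × ℕ,
      k.coeff p.1 p.2 * k'.coeff p'.1 p'.2 - k.coeff p'.1 p'.2 * k'.coeff p.1 p.2 ≠ 0 := by
  have : Fact (1 < q) := ⟨hq⟩
  rcases lt_trichotomy (k.1 j₀) (k'.1 j₀) with h | h | h
  · refine ⟨(j₀, k.1 j₀), (j₀, k'.1 j₀), ?_⟩
    simp [coeff_degree, coeff_of_degree_lt k h]
  · obtain ⟨j, r, hjr⟩ : ∃ j r, k.coeff j r ≠ k'.coeff j r := by
      by_contra! hall
      exact hk (coeff_injective hq (funext fun j => funext fun r => hall j r))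
    refine ⟨(j₀, k.1 j₀), (j, r), ?_⟩
    have h1 : k'.coeff j₀ (k.1 j₀) = 1 := h ▸ coeff_degree k' j₀
    simpa [coeff_degree, h1, sub_eq_zero] using hjr.symm
  · refine ⟨(j₀, k.1 j₀), (j₀, k'.1 j₀), ?_⟩
    simp [coeff_degree, coeff_of_degree_lt k' h]

/-- The pairing of the coefficients of `k` with the first `a` columns of the matrices. -/
def columnForm (k : MonicTuple d q) (a : ℕ) :
    (Fin d → ℕ → ℕ → ZMod q) →+ (Fin a → ZMod q) where
  toFun C i := ∑ j, ∑ r ∈ Finset.range (k.1 j + 1), k.coeff j r * C j r i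
  map_zero' := by ext; simp
  map_add' C D := by
    ext i
    simp [mul_add, Finset.sum_add_distrib]

theorem columnForm_apply (k : MonicTuple d q) (a : ℕ) (C : Fin d → ℕ → ℕ → ZMod q)
    (i : Fin a) : k.columnForm a C i =
      ∑ j, ∑ r ∈ Finset.range (k.1 j + 1), k.coeff j r * C j r i := rfl

/-- The matrices whose only nonzero row is `w`, at position `p`. -/
def singleRow (p : Fin d × ℕ) (w : ℕ → ZMod q) (j : Fin d) (r i : ℕ) : ZMod q :=
  if j = p.1 then if r = p.2 then w i else 0 else 0

theorem columnForm_singleRow (k : MonicTuple d q) (a : ℕ) (p : Fin d × ℕ) (w : ℕ → ZMod q)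
    (i : Fin a) : k.columnForm a (singleRow p w) i = k.coeff p.1 p.2 * w i := by
  rw [columnForm_apply, Finset.sum_eq_single p.1]
  · by_cases h : p.2 < k.1 p.1 + 1
    · simp [singleRow, h]
    · simp [singleRow, h, coeff_of_degree_lt k (j := p.1) (r := p.2) (by omega)]
  · intro j _ hj
    simp [singleRow, hj]
  · simp

theorem columnForm_surjective (j₀ : Fin d) (k : MonicTuple d q) (a : ℕ) :
    Function.Surjective (k.columnForm a) := fun w =>
  ⟨singleRow (j₀, k.1 j₀) (Function.extend Fin.val w 0), funext fun i => by
    rw [columnForm_singleRow, coeff_degree, one_mul, Fin.val_injective.extend_apply]⟩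

theorem columnForm_prod_surjective (hq : q.Prime) (j₀ : Fin d) {k k' : MonicTuple d q}
    (hk : k ≠ k') (a a' : ℕ) :
    Function.Surjective ((k.columnForm a).prod (k'.columnForm a')) := by
  have : Fact q.Prime := ⟨hq⟩
  rintro ⟨w, w'⟩
  obtain ⟨p, p', hΔ⟩ := exists_minor_ne_zero hq.one_lt j₀ hk
  set Δ := k.coeff p.1 p.2 * k'.coeff p'.1 p'.2 - k.coeff p'.1 p'.2 * k'.coeff p.1 p.2 with hΔ'
  let W : ℕ → ZMod q := Function.extend Fin.val w 0
  let W' : ℕ → ZMod q := Function.extend Fin.val w' 0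
  have hW : ∀ i : Fin a, W i = w i := fun i => Fin.val_injective.extend_apply _ _ _
  have hW' : ∀ i : Fin a', W' i = w' i := fun i => Fin.val_injective.extend_apply _ _ _
  refine ⟨singleRow p (fun i => Δ⁻¹ * (k'.coeff p'.1 p'.2 * W i - k.coeff p'.1 p'.2 * W' i)) +
    singleRow p' (fun i => Δ⁻¹ * (k.coeff p.1 p.2 * W' i - k'.coeff p.1 p.2 * W i)), ?_⟩
  rw [AddMonoidHom.prod_apply]
  refine Prod.ext (funext fun i => ?_) (funext fun i => ?_)
  · simp only [map_add, Pi.add_apply, columnForm_singleRow, ← hW]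
    field_simp
    rw [hΔ']
    ring
  · simp only [map_add, Pi.add_apply, columnForm_singleRow, ← hW']
    field_simp
    rw [hΔ']
    ring

/-- A finite set of matrix positions containing all those that `k.columnForm a` reads. -/
def positions (k : MonicTuple d q) (a : ℕ) : Finset (Fin d × ℕ × ℕ) :=
  Finset.univ ×ˢ Finset.range (∑ j, k.1 j + 1) ×ˢ Finset.range a

theorem columnForm_eq_zero_of_positions (k : MonicTuple d q) (a : ℕ)
    (C : Fin d → ℕ → ℕ → ZMod q) (hC : ∀ p ∈ k.positions a, C p.1 p.2.1 p.2.2 = 0) :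
    k.columnForm a C = 0 := by
  ext i
  rw [columnForm_apply]
  refine Finset.sum_eq_zero fun j _ => Finset.sum_eq_zero fun r hr => ?_
  have hle : k.1 j ≤ ∑ j, k.1 j :=
    Finset.single_le_sum (f := k.1) (fun _ _ => Nat.zero_le _) (Finset.mem_univ j)
  have hr' := Finset.mem_range.1 hr
  rw [hC (j, r, i) ?_, mul_zero]
  simp only [positions, Finset.mem_product, Finset.mem_univ, Finset.mem_range, true_and]
  exact ⟨by omega, i.2⟩

variable {μ : Measure (Fin d → ℕ → ℕ → ZMod q)}

theorem measure_columnForm_eq_zero (hq : q.Prime)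
    (hμ : ∀ (s : Finset (Fin d × ℕ × ℕ)) (v : Fin d × ℕ × ℕ → ZMod q),
      μ {C | ∀ p ∈ s, C p.1 p.2.1 p.2.2 = v p} = ((q : ENNReal))⁻¹ ^ s.card)
    (j₀ : Fin d) (k : MonicTuple d q) (a : ℕ) :
    MeasurableSet {C | k.columnForm a C = 0} ∧
      μ {C | k.columnForm a C = 0} = ((q : ENNReal) ^ a)⁻¹ := by
  have h := measure_addMonoidHom_eq_zero hq μ hμ _ (k.columnForm_surjective j₀ a)
    (k.positions a) (k.columnForm_eq_zero_of_positions a)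
  simpa [Nat.card_fun] using h

theorem measure_columnForm_inter (hq : q.Prime)
    (hμ : ∀ (s : Finset (Fin d × ℕ × ℕ)) (v : Fin d × ℕ × ℕ → ZMod q),
      μ {C | ∀ p ∈ s, C p.1 p.2.1 p.2.2 = v p} = ((q : ENNReal))⁻¹ ^ s.card)
    (j₀ : Fin d) {k k' : MonicTuple d q} (hk : k ≠ k') (a a' : ℕ) :
    μ ({C | k.columnForm a C = 0} ∩ {C | k'.columnForm a' C = 0}) =
      μ {C | k.columnForm a C = 0} * μ {C | k'.columnForm a' C = 0} := by
  have h := (measure_addMonoidHom_eq_zero hq μ hμ _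
    (columnForm_prod_surjective hq j₀ hk a a') (k.positions a ∪ k'.positions a')
    fun C hC => Prod.ext
      (k.columnForm_eq_zero_of_positions a C fun p hp => hC p (Finset.mem_union_left _ hp))
      (k'.columnForm_eq_zero_of_positions a' C fun p hp =>
        hC p (Finset.mem_union_right _ hp))).2
  have hset : {C | k.columnForm a C = 0} ∩ {C | k'.columnForm a' C = 0} =
      {C | (k.columnForm a).prod (k'.columnForm a') C = 0} := by
    ext C
    simp [Prod.ext_iff]
  rw [hset, h, (measure_columnForm_eq_zero hq hμ j₀ k a).2,
    (measure_columnForm_eq_zero hq hμ j₀ k' a').2,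
    ← ENNReal.mul_inv (Or.inr (by finiteness)) (Or.inl (by finiteness))]
  simp [Nat.card_fun]

end MonicTuple

theorem le_disc_of_forall_notMem {ι : Type*} [Fintype ι] (z : ℕ → ι → ℝ) (N : ℕ) (u v : ι → ℝ)
    (huv : ∀ i, 0 ≤ u i ∧ u i ≤ v i ∧ v i ≤ 1)
    (hz : ∀ n < N, ¬ ∀ i, u i ≤ z n i ∧ z n i < v i) :
    ∏ i, (v i - u i) ≤ disc z N := by
  refine le_csSup ⟨1, ?_⟩ ⟨u, v, huv, ?_⟩
  · rintro r ⟨u, v, huv, rfl⟩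
    have h1 : 0 ≤ ∏ i, (v i - u i) :=
      Finset.prod_nonneg fun i _ => by linarith [(huv i).2.1]
    have h2 : ∏ i, (v i - u i) ≤ 1 :=
      Finset.prod_le_one (fun i _ => by linarith [(huv i).2.1])
        fun i _ => by linarith [(huv i).1, (huv i).2.2]
    have h3 : Nat.card {n : ℕ // n < N ∧ ∀ i, u i ≤ z n i ∧ z n i < v i} ≤ N := by
      calc _ ≤ Nat.card (Set.Iio N) :=
            Nat.card_mono (Set.finite_Iio N) fun n hn => hn.1
        _ = N := by simp
    have h4 : (Nat.card {n : ℕ // n < N ∧ ∀ i, u i ≤ z n i ∧ z n i < v i} : ℝ) / N ≤ 1 :=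
      div_le_one_of_le₀ (by exact_mod_cast h3) (Nat.cast_nonneg _)
    have h5 : 0 ≤ (Nat.card {n : ℕ // n < N ∧ ∀ i, u i ≤ z n i ∧ z n i < v i} : ℝ) / N := by
      positivity
    exact abs_le.2 ⟨by linarith, by linarith⟩
  · have : IsEmpty {n : ℕ // n < N ∧ ∀ i, u i ≤ z n i ∧ z n i < v i} :=
      ⟨fun n => hz n.1 n.2.1 n.2.2⟩
    rw [Nat.card_of_isEmpty, Nat.cast_zero, zero_div, zero_sub, abs_neg, abs_of_nonneg]
    exact Finset.prod_nonneg fun i _ => by linarith [(huv i).2.1]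

theorem digitalSeq_eq_ofDigits {q : ℕ} [NeZero q] (d : ℕ) (C : Fin d → ℕ → ℕ → ZMod q) (n : ℕ)
    (j : Fin d) :
    digitalSeq d C n j = Real.ofDigits fun r =>
      (⟨(∑ i ∈ Finset.range (Nat.digits q n).length,
        C j r i * ((Nat.digits q n).getD i 0 : ZMod q)).val, ZMod.val_lt _⟩ : Fin q) := rfl

namespace MonicTuple

/-- If `k` annihilates the first `a` columns, then the first `q ^ a` points of the digital
sequence miss a box whose volume is governed by the degrees of `k`. -/
theorem le_disc {d q : ℕ} (hq : q.Prime) (j₀ : Fin d) (k : MonicTuple d q) (a : ℕ)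
    (C : Fin d → ℕ → ℕ → ZMod q) (hC : k.columnForm a C = 0) :
    1 / 2 * ((q : ℝ) ^ ∑ j, (k.1 j + 1))⁻¹ ≤ disc (digitalSeq d C) (q ^ a) := by
  have : Fact q.Prime := ⟨hq⟩
  have hq2 : (2 : ℝ) ≤ q := by exact_mod_cast hq.two_le
  let e : Fin d → ℝ := fun j => ((q : ℝ) ^ (k.1 j + 1))⁻¹
  have he0 : ∀ j, 0 < e j := fun j => by positivity
  have he1 : ∀ j, 2 * e j ≤ 1 := fun j => by
    have : (q : ℝ) ^ 1 ≤ (q : ℝ) ^ (k.1 j + 1) :=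
      pow_le_pow_right₀ (by linarith) (by omega)
    simp only [e, ← div_eq_mul_inv]
    rw [div_le_one (by positivity)]
    linarith
  let u : Fin d → ℝ := fun j => if j = j₀ then 3 / 2 * e j else 0
  let v : Fin d → ℝ := fun j => if j = j₀ then 2 * e j else e j
  have hvol : ∏ j, (v j - u j) = 1 / 2 * ((q : ℝ) ^ ∑ j, (k.1 j + 1))⁻¹ := by
    have h1 : ∀ j, v j - u j = (if j = j₀ then 1 / 2 else 1) * e j := by
      intro j
      by_cases h : j = j₀
      · simp only [u, v, h, if_true]
        ring
      · simp [u, v, h]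
    rw [Finset.prod_congr rfl fun j _ => h1 j, Finset.prod_mul_distrib, Finset.prod_ite_eq']
    simp [e, Finset.prod_pow_eq_pow_sum]
  rw [← hvol]
  refine le_disc_of_forall_notMem _ _ u v (fun j => ?_) fun n hn hbox => ?_
  · have := he0 j
    have := he1 j
    by_cases h : j = j₀
    · simp only [u, v, h, if_true] at *
      exact ⟨by positivity, by linarith, by linarith⟩
    · simp only [u, v, h, if_false]
      exact ⟨le_rfl, by linarith, by linarith⟩
  let y : Fin d → ℕ → ZMod q := fun j r => ∑ i ∈ Finset.range (Nat.digits q n).length,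
    C j r i * ((Nat.digits q n).getD i 0 : ZMod q)
  have hother : ∀ j ≠ j₀, ∀ r ∈ Finset.range (k.1 j + 1), y j r = 0 := by
    intro j hj r hr
    have h := (hbox j).2
    rw [digitalSeq_eq_ofDigits] at h
    simp only [v, hj, if_false] at h
    refine (ZMod.val_eq_zero _).1 (ofDigits_digit_eq_zero hq.two_le _ (i := r) ?_ h)
    have hpow : (q : ℝ) ^ (r + 1) ≤ (q : ℝ) ^ (k.1 j + 1) :=
      pow_le_pow_right₀ (by linarith) (Finset.mem_range.1 hr)
    simp only [e]
    rw [inv_mul_le_one₀ (by positivity)]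
    exact hpow
  have hmain : (∀ r < k.1 j₀, y j₀ r = 0) ∧ y j₀ (k.1 j₀) = 1 := by
    have h := hbox j₀
    rw [digitalSeq_eq_ofDigits] at h
    simp only [u, v, if_true] at h
    obtain ⟨h0, h1⟩ := ofDigits_digit_eq_one hq.two_le _ h.1 h.2
    exact ⟨fun r hr => (ZMod.val_eq_zero _).1 (h0 r hr), (ZMod.val_eq_one hq.one_lt _).1 h1⟩
  have hone : ∑ j, ∑ r ∈ Finset.range (k.1 j + 1), k.coeff j r * y j r = 1 := by
    rw [Finset.sum_eq_single j₀, Finset.sum_range_succ, Finset.sum_eq_zero, hmain.2,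
      coeff_degree, zero_add, one_mul]
    · intro r hr
      rw [hmain.1 r (Finset.mem_range.1 hr), mul_zero]
    · intro j _ hj
      exact Finset.sum_eq_zero fun r hr => by rw [hother j hj r hr, mul_zero]
    · simp
  have hzero : ∑ j, ∑ r ∈ Finset.range (k.1 j + 1), k.coeff j r * y j r = 0 := by
    have hlen := (Nat.digits_length_le_iff hq.one_lt n).2 hn
    calc _ = ∑ i ∈ Finset.range (Nat.digits q n).length,
          (∑ j, ∑ r ∈ Finset.range (k.1 j + 1), k.coeff j r * C j r i) *
            ((Nat.digits q n).getD i 0 : ZMod q) := by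
          simp only [y, Finset.mul_sum, Finset.sum_mul, mul_assoc]
          exact (Finset.sum_congr rfl fun j _ => Finset.sum_comm).trans Finset.sum_comm
      _ = 0 := by
          refine Finset.sum_eq_zero fun i hi => ?_
          have hi' : i < a := (Finset.mem_range.1 hi).trans_le hlen
          have := congrFun hC ⟨i, hi'⟩
          rw [columnForm_apply] at this
          rw [this, Pi.zero_apply, zero_mul]
  exact one_ne_zero (hone.symm.trans hzero)

end MonicTuple

/-- The degree vectors all of whose entries lie in `[q ^ l, 2 * q ^ l)`. -/
def degreeBlock (d q l : ℕ) : Finset (Fin d → ℕ) :=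
  Fintype.piFinset fun _ => Finset.Ico (q ^ l) (2 * q ^ l)

theorem card_degreeBlock (d q l : ℕ) : (degreeBlock d q l).card = (q ^ l) ^ d := by
  simp [degreeBlock, two_mul]

theorem log_of_mem_degreeBlock {d q l : ℕ} (hq : 2 ≤ q) {n : Fin d → ℕ}
    (hn : n ∈ degreeBlock d q l) (j : Fin d) : Nat.log q (n j) = l := by
  have h := Finset.mem_Ico.1 (Fintype.mem_piFinset.1 hn j)
  refine Nat.log_eq_of_pow_le_of_lt_pow h.1 (h.2.trans_le ?_)
  rw [pow_succ']
  exact Nat.mul_le_mul_right _ hq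

/-- The number of columns which a tuple of degrees `n` is required to annihilate. -/
def columnCount {d : ℕ} (q : ℕ) (j₀ : Fin d) (n : Fin d → ℕ) : ℕ :=
  ∑ j, n j + d * Nat.log q (n j₀) + Nat.log q (Nat.log q (n j₀))

theorem columnCount_of_mem_degreeBlock {d q l : ℕ} (hq : 2 ≤ q) (j₀ : Fin d) {n : Fin d → ℕ}
    (hn : n ∈ degreeBlock d q l) :
    columnCount q j₀ n = ∑ j, n j + d * l + Nat.log q l := by
  rw [columnCount, log_of_mem_degreeBlock hq hn]

theorem sum_degreeBlock {d q : ℕ} [NeZero q] (hq : q.Prime) (j₀ : Fin d) (l : ℕ) :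
    ∑ n ∈ degreeBlock d q l, ∑ _c : (∀ j, Fin (n j) → ZMod q),
      ((q : ℝ) ^ columnCount q j₀ n)⁻¹ = ((q : ℝ) ^ Nat.log q l)⁻¹ := by
  have hq0 : (q : ℝ) ≠ 0 := by exact_mod_cast hq.ne_zero
  have h : ∀ n ∈ degreeBlock d q l, ∑ _c : (∀ j, Fin (n j) → ZMod q),
      ((q : ℝ) ^ columnCount q j₀ n)⁻¹ = (((q : ℝ) ^ l) ^ d)⁻¹ * ((q : ℝ) ^ Nat.log q l)⁻¹ := by
    intro n hn
    rw [columnCount_of_mem_degreeBlock hq.two_le j₀ hn, Finset.sum_const, nsmul_eq_mul,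
      Finset.card_univ]
    simp only [Fintype.card_pi, ZMod.card, Finset.prod_const, Finset.card_univ,
      Fintype.card_fin, Finset.prod_pow_eq_pow_sum, Nat.cast_pow]
    rw [pow_add, pow_add, mul_comm d l, pow_mul]
    field_simp
  rw [Finset.sum_congr rfl h, Finset.sum_const, card_degreeBlock, nsmul_eq_mul]
  push_cast
  rw [mul_inv_cancel_left₀ (by positivity)]

theorem exists_finset_sum_ge {d q : ℕ} (hq : q.Prime) (j₀ : Fin d) (m : ℕ) (S : ℝ) :
    ∃ F : Finset (MonicTuple d q), (∀ k ∈ F, ∃ l, m ≤ l ∧ k.1 ∈ degreeBlock d q l) ∧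
      S ≤ ∑ k ∈ F, ((q : ℝ) ^ columnCount q j₀ k.1)⁻¹ := by
  have : NeZero q := ⟨hq.ne_zero⟩
  obtain ⟨M, hM, hmM⟩ := ((Real.tendsto_sum_range_one_div_nat_succ_atTop.eventually_ge_atTop
    (S + ∑ i ∈ Finset.range m, 1 / ((i : ℝ) + 1))).and (Filter.eventually_ge_atTop m)).exists
  refine ⟨((Finset.Ico m M).biUnion (degreeBlock d q)).sigma fun _ => Finset.univ, ?_, ?_⟩
  · intro k hk
    obtain ⟨l, hl, hkl⟩ := Finset.mem_biUnion.1 (Finset.mem_sigma.1 hk).1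
    exact ⟨l, (Finset.mem_Ico.1 hl).1, hkl⟩
  · rw [Finset.sum_sigma, Finset.sum_biUnion]
    · simp only [sum_degreeBlock hq j₀]
      have hIco := Finset.sum_Ico_eq_sub (fun i : ℕ => 1 / ((i : ℝ) + 1)) hmM
      calc S ≤ ∑ i ∈ Finset.Ico m M, 1 / ((i : ℝ) + 1) := by linarith
        _ ≤ _ := by
          refine Finset.sum_le_sum fun l _ => ?_
          rw [one_div]
          have hpos : (0 : ℝ) < (q : ℝ) ^ Nat.log q l := by
            have : (0 : ℝ) < q := by exact_mod_cast hq.pos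
            positivity
          refine inv_anti₀ hpos ?_
          have : q ^ Nat.log q l ≤ l + 1 := by
            rcases eq_or_ne l 0 with rfl | hl
            · simp
            · exact (Nat.pow_log_le_self q hl).trans (Nat.le_succ l)
          exact_mod_cast this
    · intro l _ l' _ hne
      refine Finset.disjoint_left.2 fun n hn hn' => hne ?_
      rw [← log_of_mem_degreeBlock hq.two_le hn j₀, log_of_mem_degreeBlock hq.two_le hn' j₀]

/-- The growth estimate relating the volume of the missed box to `(log N) ^ d * log log N`. -/
theorem log_bound_of_mem_degreeBlock {d q l : ℕ} (hq : q.Prime) (j₀ : Fin d) (hl : 1 ≤ l)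
    {n : Fin d → ℕ} (hn : n ∈ degreeBlock d q l) :
    (2 * (q : ℝ) ^ (d + 1) * (4 * d * q) ^ d * (4 * d * q + q))⁻¹ *
        Real.log (q ^ columnCount q j₀ n : ℕ) ^ d *
        Real.log (Real.log (q ^ columnCount q j₀ n : ℕ)) / (q ^ columnCount q j₀ n : ℕ) ≤
      1 / 2 * ((q : ℝ) ^ ∑ j, (n j + 1))⁻¹ := by
  have hq1 : (1 : ℝ) < q := by exact_mod_cast hq.one_lt
  have hd : 1 ≤ d := Nat.one_le_iff_ne_zero.2 (fun h => by subst h; exact j₀.elim0)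
  have hd' : (1 : ℝ) ≤ d := by exact_mod_cast hd
  have hl' : (1 : ℝ) ≤ l := by exact_mod_cast hl
  have hlogq : 0 < Real.log q := Real.log_pos hq1
  have hlogq' : Real.log q ≤ q := Real.log_le_self (by linarith)
  have ha := columnCount_of_mem_degreeBlock hq.two_le j₀ hn
  have hsum : ∑ j, n j ≤ d * (2 * q ^ l) := by
    calc ∑ j, n j ≤ ∑ _j : Fin d, 2 * q ^ l :=
          Finset.sum_le_sum fun j _ => (Finset.mem_Ico.1 (Fintype.mem_piFinset.1 hn j)).2.le
      _ = d * (2 * q ^ l) := by simp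
  have hlpow : l ≤ q ^ l := (Nat.lt_pow_self hq.one_lt).le
  have hle : columnCount q j₀ n ≤ 4 * d * q ^ l := by
    have h1 : Nat.log q l ≤ l := Nat.log_le_self q l
    have h2 : d * l ≤ d * q ^ l := Nat.mul_le_mul_left d hlpow
    have h3 : 1 * q ^ l ≤ d * q ^ l := Nat.mul_le_mul_right _ hd
    rw [ha]
    nlinarith
  have hpos : 1 ≤ columnCount q j₀ n := by
    rw [ha]
    have : 1 * 1 ≤ d * l := Nat.mul_le_mul hd hl
    omega
  have hN : Real.log (q ^ columnCount q j₀ n : ℕ) = columnCount q j₀ n * Real.log q := by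
    rw [Nat.cast_pow, Real.log_pow]
  set B : ℝ := 4 * d * q with hB
  have hB0 : 0 < B := by positivity
  have hlogN0 : 0 < Real.log (q ^ columnCount q j₀ n : ℕ) := by
    rw [hN]
    have : (0 : ℝ) < columnCount q j₀ n := by exact_mod_cast hpos
    positivity
  have hlogN : Real.log (q ^ columnCount q j₀ n : ℕ) ≤ B * q ^ l := by
    rw [hN]
    have : (columnCount q j₀ n : ℝ) ≤ 4 * d * q ^ l := by exact_mod_cast hle
    calc _ ≤ (4 * d * q ^ l : ℝ) * q := by gcongr
      _ = B * q ^ l := by rw [hB]; ring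
  have hloglogN : Real.log (Real.log (q ^ columnCount q j₀ n : ℕ)) ≤ (B + q) * l := by
    calc _ ≤ Real.log (B * q ^ l) := Real.log_le_log hlogN0 hlogN
      _ = Real.log B + l * Real.log q := by
          rw [Real.log_mul hB0.ne' (by positivity), Real.log_pow]
      _ ≤ B * l + l * q := by
          have h1 : Real.log B ≤ B * l :=
            (Real.log_le_self hB0.le).trans (le_mul_of_one_le_right hB0.le hl')
          gcongr
      _ = (B + q) * l := by ring
  have hprod : Real.log (q ^ columnCount q j₀ n : ℕ) ^ d *
      Real.log (Real.log (q ^ columnCount q j₀ n : ℕ)) ≤ (B * q ^ l) ^ d * ((B + q) * l) := by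
    calc _ ≤ Real.log (q ^ columnCount q j₀ n : ℕ) ^ d * ((B + q) * l) := by gcongr
      _ ≤ _ := by gcongr
  have hlq : (l : ℝ) ≤ q ^ Nat.log q l * q := by
    have := (Nat.lt_pow_succ_log_self hq.one_lt l).le
    rw [Nat.succ_eq_add_one, pow_succ] at this
    exact_mod_cast this
  rw [div_le_iff₀ (by have := hq.pos; positivity), mul_assoc]
  calc _ ≤ (2 * (q : ℝ) ^ (d + 1) * B ^ d * (B + q))⁻¹ * ((B * q ^ l) ^ d * ((B + q) * l)) := by
        gcongr
    _ ≤ (2 * (q : ℝ) ^ (d + 1) * B ^ d * (B + q))⁻¹ *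
          ((B * q ^ l) ^ d * ((B + q) * (q ^ Nat.log q l * q))) := by gcongr
    _ = 1 / 2 * ((q : ℝ) ^ ∑ j, (n j + 1))⁻¹ * (q ^ columnCount q j₀ n : ℕ) := by
        have hcard : ∑ j, (n j + 1) = ∑ j, n j + d := by
          simp [Finset.sum_add_distrib]
        rw [ha, hcard, Nat.cast_pow]
        simp only [pow_add, mul_pow, pow_one]
        rw [mul_comm d l, pow_mul]
        field_simp

theorem stmt4 (d : ℕ) (hd : 1 ≤ d) (q : ℕ) (hq : q.Prime)
    (μ : Measure (Fin d → ℕ → ℕ → ZMod q)) [IsProbabilityMeasure μ]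
    (hμ : ∀ (s : Finset (Fin d × ℕ × ℕ)) (v : Fin d × ℕ × ℕ → ZMod q),
      μ {C | ∀ p ∈ s, C p.1 p.2.1 p.2.2 = v p} = ((q : ENNReal))⁻¹ ^ s.card) :
    ∃ c > 0, ∀ᵐ C ∂μ, ∀ m : ℕ, ∃ N : ℕ, m ≤ N ∧
      c * Real.log N ^ d * Real.log (Real.log N) / N ≤ disc (digitalSeq d C) N := by
  have hq0 : (0 : ℝ) < q := by exact_mod_cast hq.pos
  have hd0 : (0 : ℝ) < d := by exact_mod_cast hd
  let j₀ : Fin d := ⟨0, hd⟩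
  refine ⟨(2 * (q : ℝ) ^ (d + 1) * (4 * d * q) ^ d * (4 * d * q + q))⁻¹, by positivity,
    ae_all_iff.2 fun m => ?_⟩
  have hmeas := fun k : MonicTuple d q =>
    k.measure_columnForm_eq_zero hq hμ j₀ (columnCount q j₀ k.1)
  have hex := ae_exists_mem_of_pairwise_independent μ
    (fun k : MonicTuple d q => {C | k.columnForm (columnCount q j₀ k.1) C = 0})
    (fun k => (hmeas k).1) {k | ∃ l, m + 1 ≤ l ∧ k.1 ∈ degreeBlock d q l}
    (fun k k' hk => MonicTuple.measure_columnForm_inter hq hμ j₀ hk _ _)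
    (fun S => by
      obtain ⟨F, hF, hS⟩ := exists_finset_sum_ge hq j₀ (m + 1) S
      refine ⟨F, hF, hS.trans (le_of_eq (Finset.sum_congr rfl fun k _ => ?_))⟩
      rw [measureReal_def, (hmeas k).2]
      simp)
  filter_upwards [hex] with C hC
  obtain ⟨k, ⟨l, hl, hk⟩, hkC⟩ := hC
  refine ⟨q ^ columnCount q j₀ k.1, ?_,
    (log_bound_of_mem_degreeBlock hq j₀ (by omega) hk).trans (k.le_disc hq j₀ _ C hkC)⟩
  have h1 : l ≤ columnCount q j₀ k.1 := by
    rw [columnCount_of_mem_degreeBlock hq.two_le j₀ hk]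
    have : 1 * l ≤ d * l := Nat.mul_le_mul_right l hd
    omega
  have h2 : columnCount q j₀ k.1 < q ^ columnCount q j₀ k.1 := Nat.lt_pow_self hq.one_lt
  omega
end
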